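/- Let k₁, k₂ be constants with k₂² > 2k₁ > 0, set λ₁ = √(k₂ + √(k₂² − 2k₁)) and λ₂ = √(k₂ − √(k₂² − 2k₁)), and define s₀(t) = (λ₁² + λ₂²)·sinh(λ₁t)·sinh(λ₂t) + 2λ₁λ₂(1 − cosh(λ₁t)·cosh(λ₂t)), s₁(t) = λ₁λ₂(λ₁² − λ₂²)(λ₁·sinh(λ₁t)·cosh(λ₂t) − λ₂·cosh(λ₁t)·sinh(λ₂t)), s₂(t) = λ₁λ₂((λ₁² + λ₂²)(cosh(λ₁t)·cosh(λ₂t) − 1) − 2λ₁λ₂·sinh(λ₁t)·sinh(λ₂t)). Assume ∇²h ≥ [[−k₁ I, 0],[0, −k₂ I]] (in n×n block form) everywhere. Then for every t ∈ (0,T) and every (x,v) ∈ ℝⁿ×ℝⁿ, the 2n×2n symmetric matrix inequality ∇² log ρ(t,x,v) − ½∇²U(x,v) ≥ ½·[[−(s₁(t)/s₀(t)) I, (s₂(t)/s₀(t)) I],[(s₂(t)/s₀(t)) I, −(s₀'(t)/s₀(t)) I]] holds. -/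

import Mathlib

noncomputable section
open Real Set Matrix

/-- `ℝⁿ` with the Euclidean norm. -/
abbrev E (n : ℕ) := EuclideanSpace ℝ (Fin n)

/-- The standard basis of `ℝⁿ × ℝⁿ`, indexed by `Fin n ⊕ Fin n`: `Sum.inl i` is the `i`-th
`x`-direction and `Sum.inr i` is the `i`-th `v`-direction. -/
def stdBasis (n : ℕ) : Fin n ⊕ Fin n → E n × E n
  | Sum.inl i => (EuclideanSpace.single i 1, 0)
  | Sum.inr i => (0, EuclideanSpace.single i 1)

/-- Partial derivative of `φ : ℝⁿ × ℝⁿ → ℝ` in the `j`-th coordinate direction. -/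
def pd {n : ℕ} (φ : E n × E n → ℝ) (j : Fin n ⊕ Fin n) (p : E n × E n) : ℝ :=
  fderiv ℝ φ p (stdBasis n j)

/-- The full Hessian of `φ` in the variables `(x, v)`, as a `2n × 2n` matrix. -/
def Hess {n : ℕ} (φ : E n × E n → ℝ) (p : E n × E n) :
    Matrix (Fin n ⊕ Fin n) (Fin n ⊕ Fin n) ℝ :=
  Matrix.of fun i j => pd (pd φ j) i p

/-- The Laplacian in the `v`-variables: `Δ_v φ = Σᵢ ∂²φ/∂vᵢ²`. -/
def lapV {n : ℕ} (φ : E n × E n → ℝ) (p : E n × E n) : ℝ :=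
  ∑ i : Fin n, pd (pd φ (Sum.inr i)) (Sum.inr i) p

/-- The squared Euclidean norm of the full gradient `∇φ`. -/
def gradNormSq {n : ℕ} (φ : E n × E n → ℝ) (p : E n × E n) : ℝ :=
  ∑ j : Fin n ⊕ Fin n, (pd φ j p) ^ 2

/-- The function `h = -½⟨v, ∇ₓU⟩ + ½Δ_v U - ¼|∇_v U|²`. -/
def hfun {n : ℕ} (U : E n × E n → ℝ) (p : E n × E n) : ℝ :=
  -(1/2) * (∑ i : Fin n, p.2 i * pd U (Sum.inl i) p) + (1/2) * lapV U p
    - (1/4) * ∑ i : Fin n, (pd U (Sum.inr i) p) ^ 2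

/-- The block-diagonal matrix `[[a·I, 0], [0, b·I]]`. -/
def blockDiag (n : ℕ) (a b : ℝ) : Matrix (Fin n ⊕ Fin n) (Fin n ⊕ Fin n) ℝ :=
  Matrix.fromBlocks (a • 1) 0 0 (b • 1)

/-- The right-hand side `½·[[-(s₁/s₀)I, (s₂/s₀)I], [(s₂/s₀)I, -(s₀'/s₀)I]]` of the
matrix differential Harnack inequality. -/
def harnackMatrix (n : ℕ) (s₀ s₁ s₂ : ℝ → ℝ) (t : ℝ) :
    Matrix (Fin n ⊕ Fin n) (Fin n ⊕ Fin n) ℝ :=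
  (1/2 : ℝ) • Matrix.fromBlocks (-(s₁ t / s₀ t) • 1) ((s₂ t / s₀ t) • 1)
    ((s₂ t / s₀ t) • 1) (-(deriv s₀ t / s₀ t) • 1)

/-- `λ₁ = √(k₂ + √(k₂² − 2k₁))`. -/
def lam1 (k₁ k₂ : ℝ) : ℝ := Real.sqrt (k₂ + Real.sqrt (k₂ ^ 2 - 2 * k₁))

/-- `λ₂ = √(k₂ − √(k₂² − 2k₁))`. -/
def lam2 (k₁ k₂ : ℝ) : ℝ := Real.sqrt (k₂ - Real.sqrt (k₂ ^ 2 - 2 * k₁))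

/-- `s₀` in the case `k₂² > 2k₁ > 0`. -/
def s0A (k₁ k₂ t : ℝ) : ℝ :=
  ((lam1 k₁ k₂) ^ 2 + (lam2 k₁ k₂) ^ 2) * Real.sinh (lam1 k₁ k₂ * t) * Real.sinh (lam2 k₁ k₂ * t)
    + 2 * lam1 k₁ k₂ * lam2 k₁ k₂ * (1 - Real.cosh (lam1 k₁ k₂ * t) * Real.cosh (lam2 k₁ k₂ * t))

/-- `s₁` in the case `k₂² > 2k₁ > 0`. -/
def s1A (k₁ k₂ t : ℝ) : ℝ :=
  lam1 k₁ k₂ * lam2 k₁ k₂ * ((lam1 k₁ k₂) ^ 2 - (lam2 k₁ k₂) ^ 2) *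
    (lam1 k₁ k₂ * Real.sinh (lam1 k₁ k₂ * t) * Real.cosh (lam2 k₁ k₂ * t)
      - lam2 k₁ k₂ * Real.cosh (lam1 k₁ k₂ * t) * Real.sinh (lam2 k₁ k₂ * t))

/-- `s₂` in the case `k₂² > 2k₁ > 0`. -/
def s2A (k₁ k₂ t : ℝ) : ℝ :=
  lam1 k₁ k₂ * lam2 k₁ k₂ *
    (((lam1 k₁ k₂) ^ 2 + (lam2 k₁ k₂) ^ 2) *
        (Real.cosh (lam1 k₁ k₂ * t) * Real.cosh (lam2 k₁ k₂ * t) - 1)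
      - 2 * lam1 k₁ k₂ * lam2 k₁ k₂ * Real.sinh (lam1 k₁ k₂ * t) * Real.sinh (lam2 k₁ k₂ * t))

section

variable {n : ℕ}

/-- Coordinates of a point of `ℝⁿ × ℝⁿ` in the basis `stdBasis`. -/
def coord (y : E n × E n) (j : Fin n ⊕ Fin n) : ℝ := Sum.elim (fun i => y.1 i) (fun i => y.2 i) j

/-- The squared Euclidean norm on `ℝⁿ × ℝⁿ`. -/
def nsq (y : E n × E n) : ℝ := ‖y.1‖ ^ 2 + ‖y.2‖ ^ 2

/-- The Hessian of `φ` at `p` as a quadratic form. -/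
def hessForm (φ : E n × E n → ℝ) (p y : E n × E n) : ℝ :=
  ∑ i, ∑ j, coord y i * (coord y j * Hess φ p i j)

lemma coord_expand (y : E n × E n) : y = ∑ j, coord y j • _root_.stdBasis n j := by
  rw [Fintype.sum_sum_type]
  ext i
  · simp [coord, _root_.stdBasis, Pi.single_apply, Prod.fst_sum, Prod.fst_add]
  · simp [coord, _root_.stdBasis, Pi.single_apply, Prod.snd_sum, Prod.snd_add]

lemma nsq_eq_sum (y : E n × E n) : nsq y = ∑ j, coord y j ^ 2 := by
  simp [nsq, coord, EuclideanSpace.norm_sq_eq]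

lemma nsq_nonneg (y : E n × E n) : 0 ≤ nsq y := by unfold nsq; positivity

lemma fderiv_eq_sum_pd (φ : E n × E n → ℝ) (p y : E n × E n) :
    fderiv ℝ φ p y = ∑ j, coord y j * pd φ j p := by
  conv_lhs => rw [coord_expand y]
  simp [pd, map_sum]

lemma contDiff_pd {φ : E n × E n → ℝ} {k m : WithTop ℕ∞} (hφ : ContDiff ℝ k φ) (hm : m + 1 ≤ k)
    (j : Fin n ⊕ Fin n) : ContDiff ℝ m (pd φ j) := by
  unfold pd
  exact (hφ.fderiv_right hm).clm_apply contDiff_const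

lemma hasDerivAt_line {φ : E n × E n → ℝ} (hφ : Differentiable ℝ φ) (p y : E n × E n) (s : ℝ) :
    HasDerivAt (fun s : ℝ => φ (p + s • y)) (fderiv ℝ φ (p + s • y) y) s := by
  have h1 : HasDerivAt (fun s : ℝ => p + s • y) y s := by
    simpa using ((hasDerivAt_id s).smul_const y).const_add p
  exact (hφ _).hasFDerivAt.comp_hasDerivAt s h1

lemma hasDerivAt_fderiv_line {φ : E n × E n → ℝ} (hφ : ContDiff ℝ 2 φ) (p y : E n × E n) (s : ℝ) :
    HasDerivAt (fun s : ℝ => fderiv ℝ φ (p + s • y) y) (hessForm φ (p + s • y) y) s := by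
  rw [show (fun s : ℝ => fderiv ℝ φ (p + s • y) y) =
      fun s : ℝ => ∑ j, coord y j * pd φ j (p + s • y)
    from funext fun s => fderiv_eq_sum_pd φ _ y]
  have h : ∀ j, HasDerivAt (fun s : ℝ => coord y j * pd φ j (p + s • y))
      (coord y j * fderiv ℝ (pd φ j) (p + s • y) y) s := fun j =>
    (hasDerivAt_line ((contDiff_pd hφ (m := 1) (by norm_num) j).differentiable (by norm_num))
      p y s).const_mul _
  refine (HasDerivAt.fun_sum (u := Finset.univ) (fun j _ => h j)).congr_deriv ?_
  simp only [fderiv_eq_sum_pd _ (p + s • y) y, Finset.mul_sum, hessForm]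
  rw [Finset.sum_comm]
  refine Finset.sum_congr rfl fun j _ => Finset.sum_congr rfl fun i _ => ?_
  simp only [Hess, Matrix.of_apply]; ring

/-- Second order Taylor estimate on the unit interval. -/
lemma taylor_le {g g1 g2 : ℝ → ℝ} {Λ : ℝ} (h1 : ∀ s, HasDerivAt g (g1 s) s)
    (h2 : ∀ s, HasDerivAt g1 (g2 s) s) (hΛ : ∀ s ∈ Icc (0 : ℝ) 1, g2 s ≤ Λ) :
    g 1 ≤ g 0 + g1 0 + Λ / 2 := by
  have key : ∀ (f f' : ℝ → ℝ), (∀ s, HasDerivAt f (f' s) s) → (∀ s ∈ Icc (0:ℝ) 1, f' s ≤ 0) →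
      AntitoneOn f (Icc 0 1) := by
    intro f f' hf hf'
    refine antitoneOn_of_deriv_nonpos (convex_Icc 0 1)
      (fun s _ => (hf s).continuousAt.continuousWithinAt)
      (fun s _ => (hf s).differentiableAt.differentiableWithinAt) fun s hs => ?_
    rw [(hf s).deriv]
    exact hf' s (interior_subset hs)
  have a1 := key (fun s => g1 s - Λ * s) (fun s => g2 s - Λ * 1)
    (fun s => (h2 s).sub ((hasDerivAt_id s).const_mul Λ)) (fun s hs => by linarith [hΛ s hs])
  have b1 : ∀ s ∈ Icc (0:ℝ) 1, g1 s ≤ g1 0 + Λ * s := fun s hs => by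
    have := a1 (left_mem_Icc.2 zero_le_one) hs hs.1
    simp only at this; linarith
  have a2 := key (fun s => g s - g1 0 * s - Λ / 2 * s ^ 2)
    (fun s => g1 s - g1 0 * 1 - Λ / 2 * (2 * s ^ 1 * 1))
    (fun s => ((h1 s).sub ((hasDerivAt_id s).const_mul _)).sub
      (((hasDerivAt_id s).pow 2).const_mul _)) (fun s hs => by nlinarith [b1 s hs])
  have := a2 (left_mem_Icc.2 zero_le_one) (right_mem_Icc.2 zero_le_one) zero_le_one
  simp only at this; linarith

lemma le_of_hessForm_le {φ : E n × E n → ℝ} (hφ : ContDiff ℝ 2 φ) {p y : E n × E n} {Λ : ℝ}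
    (h : ∀ s ∈ Icc (0 : ℝ) 1, hessForm φ (p + s • y) y ≤ Λ) :
    φ (p + y) ≤ φ p + fderiv ℝ φ p y + Λ / 2 := by
  simpa using taylor_le (hasDerivAt_line (hφ.differentiable (by norm_num)) p y)
    (hasDerivAt_fderiv_line hφ p y) h

lemma contDiff_two_of_top {φ : E n × E n → ℝ} (hφ : ContDiff ℝ (⊤ : ℕ∞) φ) : ContDiff ℝ 2 φ :=
  contDiff_infty.1 hφ 2

lemma hessForm_neg {φ : E n × E n → ℝ} (hφ : ContDiff ℝ 2 φ) (p y : E n × E n) :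
    hessForm (fun q => -φ q) p y = -hessForm φ p y := by
  have h1 := hasDerivAt_fderiv_line hφ.neg p y 0
  have h2 := (hasDerivAt_fderiv_line hφ p y 0).neg
  have e : (fun s : ℝ => fderiv ℝ (-φ) (p + s • y) y) =
      (-fun s : ℝ => fderiv ℝ φ (p + s • y) y) := by
    ext s; rw [fderiv_neg]; simp
  change HasDerivAt (fun s : ℝ => fderiv ℝ (-φ) (p + s • y) y) _ _ at h1
  rw [e] at h1
  simpa using h1.unique h2

lemma le_of_le_hessForm {φ : E n × E n → ℝ} (hφ : ContDiff ℝ 2 φ) {p y : E n × E n} {Λ : ℝ}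
    (h : ∀ s ∈ Icc (0 : ℝ) 1, Λ ≤ hessForm φ (p + s • y) y) :
    φ p + fderiv ℝ φ p y + Λ / 2 ≤ φ (p + y) := by
  have := le_of_hessForm_le (φ := fun q => -φ q) hφ.neg (p := p) (y := y) (Λ := -Λ)
    (fun s hs => by rw [hessForm_neg hφ]; linarith [h s hs])
  rw [fderiv_fun_neg] at this
  simp at this; linarith

lemma coord_smul (s : ℝ) (y : E n × E n) (j : Fin n ⊕ Fin n) : coord (s • y) j = s * coord y j := by
  rcases j with j | j <;> simp [coord]

lemma hessForm_smul (φ : E n × E n → ℝ) (p y : E n × E n) (s : ℝ) :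
    hessForm φ p (s • y) = s ^ 2 * hessForm φ p y := by
  simp only [hessForm, coord_smul, Finset.mul_sum]
  refine Finset.sum_congr rfl fun j _ => Finset.sum_congr rfl fun i _ => by ring

lemma continuous_hessForm {φ : E n × E n → ℝ} (hφ : ContDiff ℝ 2 φ) (y : E n × E n) :
    Continuous fun p => hessForm φ p y := by
  unfold hessForm Hess
  refine continuous_finsetSum _ fun i _ => continuous_finsetSum _ fun j _ => ?_
  have :=
    (contDiff_pd (contDiff_pd hφ (m := 1) (by norm_num) j) (m := 0) (by norm_num) i).continuous
  simp only [Matrix.of_apply]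
  fun_prop

/-- A midpoint convexity inequality of second order bounds the Hessian from below. -/
lemma le_hessForm_of_midpoint {φ : E n × E n → ℝ} (hφ : ContDiff ℝ 2 φ) (p y : E n × E n) (q : ℝ)
    (h : ∀ᶠ s : ℝ in nhds 0, s ^ 2 * q ≤ φ (p + s • y) + φ (p - s • y) - 2 * φ p) :
    q ≤ hessForm φ p y := by
  by_contra! hlt
  obtain ⟨q', h1, h2⟩ := exists_between hlt
  have hc : Continuous fun s : ℝ => hessForm φ (p + s • y) y :=
    (continuous_hessForm hφ y).comp (by fun_prop)
  have hev : ∀ᶠ s in nhds (0 : ℝ), hessForm φ (p + s • y) y < q' :=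
    hc.continuousAt.eventually_lt continuousAt_const (by simpa using h1)
  obtain ⟨δ, hδ, hball'⟩ := Metric.eventually_nhds_iff.1 (hev.and h)
  have hball := fun {s : ℝ} hs => (@hball' s hs).1
  have key : ∀ r : ℝ, |r| < δ → φ (p + r • y) ≤ φ p + fderiv ℝ φ p (r • y) + r ^ 2 * q' / 2 := by
    intro r hr
    refine le_of_hessForm_le hφ fun s hs => ?_
    rw [hessForm_smul, smul_smul]
    refine mul_le_mul_of_nonneg_left (hball ?_).le (sq_nonneg r)
    rw [Real.dist_eq, sub_zero, abs_mul, abs_of_nonneg hs.1]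
    nlinarith [abs_nonneg r, hs.2]
  have k1 := key (δ / 2) (by rw [abs_of_pos (by positivity)]; linarith)
  have k2 := key (-(δ / 2)) (by rw [abs_neg, abs_of_pos (by positivity)]; linarith)
  have k3 := (@hball' (δ / 2) (by rw [Real.dist_eq, sub_zero, abs_of_pos] <;> linarith)).2
  rw [neg_smul, map_neg, ← sub_eq_add_neg] at k2
  have : 0 < (δ / 2) ^ 2 * (q - q') := mul_pos (by positivity) (by linarith)
  nlinarith

lemma hess_isHermitian {φ : E n × E n → ℝ} (hφ : ContDiff ℝ 2 φ) (p : E n × E n) :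
    (Hess φ p).IsHermitian := by
  have hd : ∀ i j, pd (pd φ j) i p =
        fderiv ℝ (fderiv ℝ φ) p (_root_.stdBasis n i) (_root_.stdBasis n j) := by
    intro i j
    have h1 : DifferentiableAt ℝ (fderiv ℝ φ) p :=
      (hφ.fderiv_right (m := 1) (by norm_num)).differentiable (by norm_num) p
    unfold pd
    rw [fderiv_clm_apply h1 (differentiableAt_const _)]
    simp
  have hs := (hφ.contDiffAt (x := p)).isSymmSndFDerivAt (by simp)
  ext i j
  simp only [Matrix.conjTranspose_apply, Hess, Matrix.of_apply, star_trivial, hd]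
  exact hs _ _

lemma form_nonneg {M : Matrix (Fin n ⊕ Fin n) (Fin n ⊕ Fin n) ℝ} (hM : M.PosSemidef)
    (y : E n × E n) : 0 ≤ ∑ i, ∑ j, coord y i * (coord y j * M i j) := by
  have := hM.dotProduct_mulVec_nonneg (coord y)
  simp only [dotProduct, mulVec, star_trivial, Finset.mul_sum] at this
  refine this.trans_eq (Finset.sum_congr rfl fun i _ => Finset.sum_congr rfl fun j _ => by ring)

lemma posSemidef_of_form {M : Matrix (Fin n ⊕ Fin n) (Fin n ⊕ Fin n) ℝ} (h : M.IsHermitian)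
    (hM : ∀ y : E n × E n, 0 ≤ ∑ i, ∑ j, coord y i * (coord y j * M i j)) : M.PosSemidef := by
  refine Matrix.PosSemidef.of_dotProduct_mulVec_nonneg h fun x => ?_
  have := hM (WithLp.toLp 2 fun i => x (Sum.inl i), WithLp.toLp 2 fun i => x (Sum.inr i))
  have e : coord (n := n)
      (WithLp.toLp 2 fun i => x (Sum.inl i), WithLp.toLp 2 fun i => x (Sum.inr i))
      = x := by ext j; rcases j with j | j <;> simp [coord]
  rw [e] at this
  simp only [dotProduct, mulVec, star_trivial, Finset.mul_sum]
  refine this.trans_eq (Finset.sum_congr rfl fun i _ => Finset.sum_congr rfl fun j _ => by ring)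

lemma form_sub (M N : Matrix (Fin n ⊕ Fin n) (Fin n ⊕ Fin n) ℝ) (y : E n × E n) :
    ∑ i, ∑ j, coord y i * (coord y j * (M - N) i j) =
      ∑ i, ∑ j, coord y i * (coord y j * M i j) - ∑ i, ∑ j, coord y i * (coord y j * N i j) := by
  simp only [← Finset.sum_sub_distrib, Matrix.sub_apply, mul_sub]

lemma form_smul (c : ℝ) (M : Matrix (Fin n ⊕ Fin n) (Fin n ⊕ Fin n) ℝ) (y : E n × E n) :
    ∑ i, ∑ j, coord y i * (coord y j * (c • M) i j) =
      c * ∑ i, ∑ j, coord y i * (coord y j * M i j) := by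
  simp only [Finset.mul_sum, Matrix.smul_apply, smul_eq_mul]
  exact Finset.sum_congr rfl fun i _ => Finset.sum_congr rfl fun j _ => by ring

lemma form_one (y : E n × E n) :
    ∑ i, ∑ j, coord y i * (coord y j * (1 : Matrix (Fin n ⊕ Fin n) (Fin n ⊕ Fin n) ℝ) i j) =
      nsq y := by
  rw [nsq_eq_sum]
  refine Finset.sum_congr rfl fun i _ => ?_
  simp [Matrix.one_apply]
  ring

/-- The quadratic form of `[[a·I, b·I], [b·I, c·I]]`. -/
def blockForm (a b c : ℝ) (y : E n × E n) : ℝ :=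
  a * ‖y.1‖ ^ 2 + 2 * b * inner ℝ y.1 y.2 + c * ‖y.2‖ ^ 2

lemma form_fromBlocks (a b c : ℝ) (y : E n × E n) :
    ∑ i, ∑ j, coord y i * (coord y j * (Matrix.fromBlocks (a • 1) (b • 1) (b • 1) (c • 1) :
      Matrix (Fin n ⊕ Fin n) (Fin n ⊕ Fin n) ℝ) i j) = blockForm a b c y := by
  simp only [blockForm, Fintype.sum_sum_type, coord, EuclideanSpace.norm_sq_eq, Real.norm_eq_abs,
    sq_abs, PiLp.inner_apply, RCLike.inner_apply, conj_trivial, Finset.mul_sum,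
    ← Finset.sum_add_distrib]
  refine Finset.sum_congr rfl fun i _ => ?_
  simp [Matrix.one_apply, Finset.sum_add_distrib]
  ring

/-- The kinetic operator `Δ_v - ⟨v, ∇ₓ⟩ + h`. -/
def kineticOp (h φ : E n × E n → ℝ) (p : E n × E n) : ℝ :=
  lapV φ p - (∑ i : Fin n, p.2 i * pd φ (Sum.inl i) p) + h p * φ p

/-- The operator `Δ_v φ + |∇_v φ|² - ⟨v, ∇ₓ φ⟩ + h`, i.e. `kineticOp` in logarithmic form. -/
def logKineticOp (h φ : E n × E n → ℝ) (p : E n × E n) : ℝ :=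
  lapV φ p + (∑ i : Fin n, (pd φ (Sum.inr i) p) ^ 2)
    - (∑ i : Fin n, p.2 i * pd φ (Sum.inl i) p) + h p

lemma pd_fun_add {φ χ : E n × E n → ℝ} (hφ : Differentiable ℝ φ) (hχ : Differentiable ℝ χ)
    (j : Fin n ⊕ Fin n) : pd (fun q => φ q + χ q) j = fun p => pd φ j p + pd χ j p := by
  ext p; unfold pd; rw [fderiv_fun_add (hφ p) (hχ p)]; rfl

lemma pd_const_mul {φ : E n × E n → ℝ} (hφ : Differentiable ℝ φ) (c : ℝ)
    (j : Fin n ⊕ Fin n) : pd (fun q => c * φ q) j = fun p => c * pd φ j p := by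
  ext p; unfold pd; rw [fderiv_const_mul (hφ p)]; rfl

lemma pd_fun_mul {φ χ : E n × E n → ℝ} (hφ : Differentiable ℝ φ) (hχ : Differentiable ℝ χ)
    (j : Fin n ⊕ Fin n) :
    pd (fun q => φ q * χ q) j = fun p => φ p * pd χ j p + χ p * pd φ j p := by
  ext p; unfold pd; rw [fderiv_fun_mul (hφ p) (hχ p)]; rfl

lemma pd_exp {φ : E n × E n → ℝ} (hφ : Differentiable ℝ φ) (j : Fin n ⊕ Fin n) :
    pd (fun q => Real.exp (φ q)) j = fun p => Real.exp (φ p) * pd φ j p := by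
  ext p; unfold pd; rw [fderiv_exp (hφ p)]; rfl

lemma differentiable_of_two {φ : E n × E n → ℝ} (hφ : ContDiff ℝ 2 φ) : Differentiable ℝ φ :=
  hφ.differentiable (by norm_num)

lemma differentiable_pd {φ : E n × E n → ℝ} (hφ : ContDiff ℝ 2 φ) (j : Fin n ⊕ Fin n) :
    Differentiable ℝ (pd φ j) :=
  (contDiff_pd hφ (m := 1) (by norm_num) j).differentiable (by norm_num)

lemma lapV_fun_add {φ χ : E n × E n → ℝ} (hφ : ContDiff ℝ 2 φ) (hχ : ContDiff ℝ 2 χ)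
    (p : E n × E n) : lapV (fun q => φ q + χ q) p = lapV φ p + lapV χ p := by
  simp only [lapV, pd_fun_add (differentiable_of_two hφ) (differentiable_of_two hχ),
    pd_fun_add (differentiable_pd hφ _) (differentiable_pd hχ _), Finset.sum_add_distrib]

lemma lapV_const_mul {φ : E n × E n → ℝ} (hφ : ContDiff ℝ 2 φ) (c : ℝ)
    (p : E n × E n) : lapV (fun q => c * φ q) p = c * lapV φ p := by
  simp only [lapV, pd_const_mul (differentiable_of_two hφ),
    pd_const_mul (differentiable_pd hφ _), Finset.mul_sum]

lemma kineticOp_fun_add {φ χ : E n × E n → ℝ} (hφ : ContDiff ℝ 2 φ) (hχ : ContDiff ℝ 2 χ)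
    (h : E n × E n → ℝ) (p : E n × E n) :
    kineticOp h (fun q => φ q + χ q) p = kineticOp h φ p + kineticOp h χ p := by
  simp only [kineticOp, lapV_fun_add hφ hχ,
    pd_fun_add (differentiable_of_two hφ) (differentiable_of_two hχ), mul_add,
    Finset.sum_add_distrib]
  ring

lemma kineticOp_const_mul {φ : E n × E n → ℝ} (hφ : ContDiff ℝ 2 φ) (c : ℝ)
    (h : E n × E n → ℝ) (p : E n × E n) :
    kineticOp h (fun q => c * φ q) p = c * kineticOp h φ p := by
  simp only [kineticOp, lapV_const_mul hφ, pd_const_mul (differentiable_of_two hφ),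
    mul_add, mul_sub, Finset.mul_sum]
  simp only [mul_left_comm]

lemma kineticOp_exp {φ : E n × E n → ℝ} (hφ : ContDiff ℝ 2 φ)
    (h : E n × E n → ℝ) (p : E n × E n) :
    kineticOp h (fun q => Real.exp (φ q)) p = Real.exp (φ p) * logKineticOp h φ p := by
  have hd := differentiable_of_two hφ
  simp only [kineticOp, logKineticOp, lapV, pd_exp hd, pd_fun_mul hd.exp (differentiable_pd hφ _)]
  simp only [mul_add, mul_sub, Finset.mul_sum, Finset.sum_add_distrib]
  simp only [sq, mul_comm, mul_left_comm, mul_assoc]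

lemma coord_stdBasis (i j : Fin n ⊕ Fin n) :
    coord (_root_.stdBasis n j) i = if i = j then 1 else 0 := by
  rcases i with i | i <;> rcases j with j | j <;>
    simp [coord, _root_.stdBasis]

lemma hessForm_stdBasis (φ : E n × E n → ℝ) (p : E n × E n) (j : Fin n ⊕ Fin n) :
    hessForm φ p (_root_.stdBasis n j) = pd (pd φ j) j p := by
  simp [hessForm, coord_stdBasis, Hess]

lemma lapV_nonneg_of_isLocalMin {φ : E n × E n → ℝ} (hφ : ContDiff ℝ 2 φ) {p : E n × E n}
    (h : IsLocalMin φ p) : 0 ≤ lapV φ p := by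
  refine Finset.sum_nonneg fun i _ => ?_
  rw [← hessForm_stdBasis]
  refine le_hessForm_of_midpoint hφ p _ 0 ?_
  have c1 : Continuous fun s : ℝ => p + s • _root_.stdBasis n (Sum.inr i) := by fun_prop
  have c2 : Continuous fun s : ℝ => p - s • _root_.stdBasis n (Sum.inr i) := by fun_prop
  have e1 := c1.tendsto' 0 p (by simp) |>.eventually h
  have e2 := c2.tendsto' 0 p (by simp) |>.eventually h
  filter_upwards [e1, e2] with s h1 h2
  linarith

lemma pd_eq_zero_of_isLocalMin {φ : E n × E n → ℝ} {p : E n × E n}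
    (h : IsLocalMin φ p) (j : Fin n ⊕ Fin n) : pd φ j p = 0 := by
  simp [pd, h.fderiv_eq_zero]

/-- At the right endpoint of an interval where a minimum is attained, the derivative is
nonpositive. -/
lemma deriv_nonpos_of_min_right {f : ℝ → ℝ} {f' s t : ℝ} (hst : s < t) (hf : HasDerivAt f f' t)
    (h : ∀ r ∈ Icc s t, f t ≤ f r) : f' ≤ 0 := by
  have hs := (hasDerivAt_iff_tendsto_slope.1 hf).mono_left
    (nhdsWithin_mono t (fun x (hx : x < t) => ne_of_lt hx) :
      nhdsWithin t (Iio t) ≤ nhdsWithin t {t}ᶜ)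
  refine le_of_tendsto hs ?_
  filter_upwards [Ioo_mem_nhdsLT hst] with r hr
  rw [slope_def_field]
  exact div_nonpos_of_nonneg_of_nonpos (by linarith [h r ⟨hr.1.le, hr.2.le⟩]) (by linarith [hr.2])

lemma fderiv_eq_of_quadratic {φ : E n × E n → ℝ} (hφ : Differentiable ℝ φ) {p y : E n × E n}
    {a b : ℝ} (h : ∀ s : ℝ, φ (p + s • y) = φ p + s * a + s ^ 2 * b) : fderiv ℝ φ p y = a := by
  have h1 := hasDerivAt_line hφ p y 0
  simp only [zero_smul, add_zero] at h1
  have h2 : HasDerivAt (fun s : ℝ => φ p + s * a + s ^ 2 * b) a 0 := by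
    have := (((hasDerivAt_id (0:ℝ)).mul_const a).const_add (φ p)).add
      (((hasDerivAt_id (0:ℝ)).pow 2).mul_const b)
    refine this.congr_deriv (by simp)
  exact (h1.congr_of_eventuallyEq (Filter.Eventually.of_forall fun s => (h s).symm)).unique h2

lemma blockForm_eq_sum (a b c : ℝ) (y : E n × E n) :
    blockForm a b c y = ∑ i, (a * y.1 i ^ 2 + 2 * b * (y.1 i * y.2 i) + c * y.2 i ^ 2) := by
  simp only [blockForm, EuclideanSpace.norm_sq_eq, Real.norm_eq_abs,
    sq_abs, PiLp.inner_apply, RCLike.inner_apply, conj_trivial, Finset.mul_sum,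
    ← Finset.sum_add_distrib]
  exact Finset.sum_congr rfl fun i _ => by ring

lemma blockForm_add_smul_inl (a b c : ℝ) (y : E n × E n) (i : Fin n) (s : ℝ) :
    blockForm a b c (y + s • _root_.stdBasis n (Sum.inl i)) =
      blockForm a b c y + s * (2 * (a * y.1 i + b * y.2 i)) + s ^ 2 * a := by
  simp only [blockForm_eq_sum, _root_.stdBasis, Prod.fst_add, Prod.snd_add, Prod.smul_fst,
    Prod.smul_snd, PiLp.add_apply, PiLp.smul_apply, smul_eq_mul, smul_zero, add_zero,
    PiLp.single_apply]
  have : ∀ x : Fin n, a * (y.1 x + s * if x = i then 1 else 0) ^ 2 +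
      2 * b * ((y.1 x + s * if x = i then 1 else 0) * y.2 x) + c * y.2 x ^ 2 =
      (a * y.1 x ^ 2 + 2 * b * (y.1 x * y.2 x) + c * y.2 x ^ 2) +
      if x = i then s * (2 * (a * y.1 i + b * y.2 i)) + s ^ 2 * a else 0 := by
    intro x; split_ifs with hx
    · subst hx; ring
    · ring
  simp only [this, Finset.sum_add_distrib, Finset.sum_ite_eq', Finset.mem_univ, if_true]
  ring

lemma blockForm_add_smul_inr (a b c : ℝ) (y : E n × E n) (i : Fin n) (s : ℝ) :
    blockForm a b c (y + s • _root_.stdBasis n (Sum.inr i)) =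
      blockForm a b c y + s * (2 * (b * y.1 i + c * y.2 i)) + s ^ 2 * c := by
  simp only [blockForm_eq_sum, _root_.stdBasis, Prod.fst_add, Prod.snd_add, Prod.smul_fst,
    Prod.smul_snd, PiLp.add_apply, PiLp.smul_apply, smul_eq_mul, smul_zero, add_zero,
    PiLp.single_apply]
  have : ∀ x : Fin n, a * y.1 x ^ 2 + 2 * b * (y.1 x * (y.2 x + s * if x = i then 1 else 0)) +
      c * (y.2 x + s * if x = i then 1 else 0) ^ 2 =
      (a * y.1 x ^ 2 + 2 * b * (y.1 x * y.2 x) + c * y.2 x ^ 2) +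
      if x = i then s * (2 * (b * y.1 i + c * y.2 i)) + s ^ 2 * c else 0 := by
    intro x; split_ifs with hx
    · subst hx; ring
    · ring
  simp only [this, Finset.sum_add_distrib, Finset.sum_ite_eq', Finset.mem_univ, if_true]
  ring

lemma pd_comp_add_right (φ : E n × E n → ℝ) (y : E n × E n) (j : Fin n ⊕ Fin n) :
    pd (fun q => φ (q + y)) j = fun p => pd φ j (p + y) := by
  ext p; simp [pd, fderiv_comp_add_right]

/-- The two-point quantity `ℓ(z + y) + ℓ(z - y) - 2 m(z) - ½ yᵀ [[a, b], [b, c]] y`. -/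
def twoPoint (ℓ m : E n × E n → ℝ) (a b c : ℝ) (z y : E n × E n) : ℝ :=
  ℓ (z + y) + ℓ (z - y) - 2 * m z - 1 / 2 * blockForm a b c y

section critical

variable {ℓ m : E n × E n → ℝ} {a b c : ℝ} {z y : E n × E n}

lemma twoPoint_critical_snd (hℓ : ContDiff ℝ 2 ℓ)
    (hmin : ∀ z' y', twoPoint ℓ m a b c z y ≤ twoPoint ℓ m a b c z' y') (i : Fin n) :
    pd ℓ (Sum.inl i) (z + y) - pd ℓ (Sum.inl i) (z - y) = a * y.1 i + b * y.2 i ∧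
    pd ℓ (Sum.inr i) (z + y) - pd ℓ (Sum.inr i) (z - y) = b * y.1 i + c * y.2 i := by
  have key : ∀ (η : E n × E n) (α β : ℝ), (∀ s : ℝ, blockForm a b c (y + s • η) =
      blockForm a b c y + s * (2 * α) + s ^ 2 * β) →
      fderiv ℝ ℓ (z + y) η - fderiv ℝ ℓ (z - y) η = α := by
    intro η α β hs
    have h1 := hasDerivAt_line (differentiable_of_two hℓ) (z + y) η 0
    have h2 := hasDerivAt_line (differentiable_of_two hℓ) (z - y) (-η) 0
    have h3 := ((((hasDerivAt_id (0:ℝ)).mul_const (2 * α)).const_add (blockForm a b c y)).add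
      (((hasDerivAt_id (0:ℝ)).pow 2).mul_const β)).const_mul (1 / 2 : ℝ)
    have h4 := ((h1.add h2).sub_const (2 * m z)).sub h3
    have h5 := IsLocalMin.hasDerivAt_eq_zero (Filter.Eventually.of_forall fun s => ?_) h4
    · simp at h5; linarith
    · have h6 := hmin z (y + s • η)
      simp only [twoPoint, hs] at h6
      simp only [Pi.sub_apply, Pi.add_apply, id, Pi.pow_apply, zero_smul, add_zero, smul_neg]
      rw [show z + y + s • η = z + (y + s • η) by abel,
        show z - y + -(s • η) = z - (y + s • η) by abel]
      norm_num at h6 ⊢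
      linarith
  exact ⟨key _ _ a fun s => blockForm_add_smul_inl a b c y i s,
    key _ _ c fun s => blockForm_add_smul_inr a b c y i s⟩

lemma twoPoint_critical_fst (hℓ : ContDiff ℝ 2 ℓ) (hm : ContDiff ℝ 2 m)
    (hmin : ∀ z' y', twoPoint ℓ m a b c z y ≤ twoPoint ℓ m a b c z' y') :
    (∀ j, pd ℓ j (z + y) + pd ℓ j (z - y) = 2 * pd m j z) ∧
    2 * lapV m z ≤ lapV ℓ (z + y) + lapV ℓ (z - y) := by
  have c1 : ContDiff ℝ 2 fun q => ℓ (q + y) := hℓ.comp (contDiff_id.add contDiff_const)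
  have c2 : ContDiff ℝ 2 fun q => ℓ (q + -y) := hℓ.comp (contDiff_id.add contDiff_const)
  have c3 : ContDiff ℝ 2 fun q => (-2) * m q := contDiff_const.mul hm
  have hl : IsLocalMin (fun q => ℓ (q + y) + ℓ (q + -y) + (-2) * m q) z := by
    refine Filter.Eventually.of_forall fun q => ?_
    have := hmin q y
    simp only [twoPoint, sub_eq_add_neg] at this ⊢
    linarith
  constructor
  · intro j
    have := pd_eq_zero_of_isLocalMin hl j
    rw [pd_fun_add (differentiable_of_two (c1.add c2)) (differentiable_of_two c3),
      pd_fun_add (differentiable_of_two c1) (differentiable_of_two c2),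
      pd_comp_add_right, pd_comp_add_right, pd_const_mul (differentiable_of_two hm)] at this
    simp only [← sub_eq_add_neg] at this
    linarith
  · have := lapV_nonneg_of_isLocalMin ((c1.add c2).add c3) hl
    rw [lapV_fun_add (c1.add c2) c3, lapV_fun_add c1 c2, lapV_const_mul hm] at this
    simp only [lapV, pd_comp_add_right, sub_eq_add_neg] at this ⊢
    linarith

/-- At a minimum of the two-point quantity, the operator applied to it is controlled by the
Riccati terms. -/
lemma twoPoint_critical (hℓ : ContDiff ℝ 2 ℓ) (hm : ContDiff ℝ 2 m)
    (hmin : ∀ z' y', twoPoint ℓ m a b c z y ≤ twoPoint ℓ m a b c z' y')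
    (h : E n × E n → ℝ) :
    1 / 2 * blockForm (b ^ 2) (b * c - a) (c ^ 2 - 2 * b) y + (h (z + y) + h (z - y) - 2 * h z) ≤
      logKineticOp h ℓ (z + y) + logKineticOp h ℓ (z - y) - 2 * logKineticOp h m z := by
  obtain ⟨h1, h2⟩ := twoPoint_critical_fst hℓ hm hmin
  have h3 := twoPoint_critical_snd hℓ hmin
  have e1 : ∀ i, pd ℓ (Sum.inl i) (z + y) = pd m (Sum.inl i) z + (a * y.1 i + b * y.2 i) / 2 :=
    fun i => by linarith [h1 (Sum.inl i), (h3 i).1]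
  have e2 : ∀ i, pd ℓ (Sum.inl i) (z - y) = pd m (Sum.inl i) z - (a * y.1 i + b * y.2 i) / 2 :=
    fun i => by linarith [h1 (Sum.inl i), (h3 i).1]
  have e3 : ∀ i, pd ℓ (Sum.inr i) (z + y) = pd m (Sum.inr i) z + (b * y.1 i + c * y.2 i) / 2 :=
    fun i => by linarith [h1 (Sum.inr i), (h3 i).2]
  have e4 : ∀ i, pd ℓ (Sum.inr i) (z - y) = pd m (Sum.inr i) z - (b * y.1 i + c * y.2 i) / 2 :=
    fun i => by linarith [h1 (Sum.inr i), (h3 i).2]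
  have e5 : 1 / 2 * blockForm (b ^ 2) (b * c - a) (c ^ 2 - 2 * b) y =
      (∑ i, pd ℓ (Sum.inr i) (z + y) ^ 2) + (∑ i, pd ℓ (Sum.inr i) (z - y) ^ 2)
        - 2 * (∑ i, pd m (Sum.inr i) z ^ 2)
      - ((∑ i, (z + y).2 i * pd ℓ (Sum.inl i) (z + y))
        + (∑ i, (z - y).2 i * pd ℓ (Sum.inl i) (z - y))
        - 2 * (∑ i, z.2 i * pd m (Sum.inl i) z)) := by
    simp only [blockForm_eq_sum, Finset.mul_sum, ← Finset.sum_add_distrib,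
      ← Finset.sum_sub_distrib, e1, e2, e3, e4]
    refine Finset.sum_congr rfl fun i _ => ?_
    simp only [Prod.snd_add, Prod.snd_sub, PiLp.add_apply, PiLp.sub_apply]
    ring
  rw [e5]
  simp only [logKineticOp]
  linarith

end critical

lemma isCompact_nsq_add_le (R : ℝ) :
    IsCompact {q : (E n × E n) × (E n × E n) | nsq q.1 + nsq q.2 ≤ R} := by
  refine Metric.isCompact_of_isClosed_isBounded ?_ ?_
  · refine isClosed_le ?_ continuous_const
    unfold nsq; fun_prop
  · refine (Metric.isBounded_closedBall (x := 0) (r := Real.sqrt R)).subset fun q hq => ?_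
    simp only [nsq, mem_ofPred_eq] at hq
    have h0 : ∀ w : E n, ‖w‖ ^ 2 ≤ R → ‖w‖ ≤ Real.sqrt R := fun w hw => Real.le_sqrt_of_sq_le hw
    have := sq_nonneg ‖q.1.1‖
    have := sq_nonneg ‖q.1.2‖
    have := sq_nonneg ‖q.2.1‖
    have := sq_nonneg ‖q.2.2‖
    simp only [mem_closedBall_zero_iff, Prod.norm_def, max_le_iff]
    exact ⟨⟨h0 _ (by linarith), h0 _ (by linarith)⟩, ⟨h0 _ (by linarith), h0 _ (by linarith)⟩⟩

/-- The two-point maximum principle. -/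
lemma twoPoint_nonneg {h : E n × E n → ℝ} {m ℓ ℓ' : ℝ → E n × E n → ℝ} {a b c : ℝ → ℝ}
    {k₁ k₂ s₀ t₁ R : ℝ}
    (hh : ∀ z y, -k₁ * ‖y.1‖ ^ 2 - k₂ * ‖y.2‖ ^ 2 ≤ h (z + y) + h (z - y) - 2 * h z)
    (hm : ∀ t ∈ Icc s₀ t₁, ContDiff ℝ 2 (m t)) (hℓ : ∀ t ∈ Icc s₀ t₁, ContDiff ℝ 2 (ℓ t))
    (hmt : ∀ t ∈ Icc s₀ t₁, ∀ z, HasDerivAt (fun s => m s z) (logKineticOp h (m t) z) t)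
    (hℓt : ∀ t ∈ Icc s₀ t₁, ∀ z, HasDerivAt (fun s => ℓ s z) (ℓ' t z) t)
    (hsup : ∀ t ∈ Icc s₀ t₁, ∀ z, logKineticOp h (ℓ t) z < ℓ' t z)
    (ha : ∀ t ∈ Icc s₀ t₁, HasDerivAt a (b t ^ 2 - 2 * k₁) t)
    (hb : ∀ t ∈ Icc s₀ t₁, HasDerivAt b (b t * c t - a t) t)
    (hc : ∀ t ∈ Icc s₀ t₁, HasDerivAt c (c t ^ 2 - 2 * b t - 2 * k₂) t)
    (hcont : ContinuousOn (fun q : ℝ × ((E n × E n) × (E n × E n)) =>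
      twoPoint (ℓ q.1) (m q.1) (a q.1) (b q.1) (c q.1) q.2.1 q.2.2) (Icc s₀ t₁ ×ˢ univ))
    (hcoer : ∀ t ∈ Icc s₀ t₁, ∀ z y, R ≤ nsq z + nsq y →
      0 ≤ twoPoint (ℓ t) (m t) (a t) (b t) (c t) z y)
    (hinit : ∀ z y, 0 ≤ twoPoint (ℓ s₀) (m s₀) (a s₀) (b s₀) (c s₀) z y) :
    ∀ t ∈ Icc s₀ t₁, ∀ z y, 0 ≤ twoPoint (ℓ t) (m t) (a t) (b t) (c t) z y := by
  by_contra! hneg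
  obtain ⟨t, ht, z, y, hlt⟩ := hneg
  have hK : IsCompact (Icc s₀ t₁ ×ˢ {q : (E n × E n) × (E n × E n) | nsq q.1 + nsq q.2 ≤ R}) :=
    isCompact_Icc.prod (isCompact_nsq_add_le R)
  have hmem : ∀ t ∈ Icc s₀ t₁, ∀ z y : E n × E n,
      twoPoint (ℓ t) (m t) (a t) (b t) (c t) z y < 0 →
      (t, (z, y)) ∈ Icc s₀ t₁ ×ˢ {q : (E n × E n) × (E n × E n) | nsq q.1 + nsq q.2 ≤ R} := by
    intro t ht z y hlt
    refine ⟨ht, ?_⟩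
    by_contra hR
    exact absurd (hcoer t ht z y (not_le.1 hR).le) (not_le.2 hlt)
  obtain ⟨⟨t, z, y⟩, ⟨ht', -⟩, hmin⟩ := hK.exists_isMinOn ⟨_, hmem t ht z y hlt⟩
    (hcont.mono (prod_mono_right (subset_univ _)))
  have hlt' := (hmin (hmem _ ht _ _ hlt)).trans_lt hlt
  simp only at hlt' ht'
  have hmin' : ∀ t' ∈ Icc s₀ t₁, ∀ z' y', twoPoint (ℓ t) (m t) (a t) (b t) (c t) z y ≤
      twoPoint (ℓ t') (m t') (a t') (b t') (c t') z' y' := by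
    intro t' ht' z' y'
    by_cases hc' : twoPoint (ℓ t') (m t') (a t') (b t') (c t') z' y' < 0
    · exact hmin (hmem _ ht' _ _ hc')
    · linarith
  have hst : s₀ < t := by
    refine lt_of_le_of_ne ht'.1 ?_
    rintro rfl
    exact absurd (hinit z y) (not_le.2 hlt')
  have hD : HasDerivAt (fun t => twoPoint (ℓ t) (m t) (a t) (b t) (c t) z y)
      (ℓ' t (z + y) + ℓ' t (z - y) - 2 * logKineticOp h (m t) z - 1 / 2 *
        blockForm (b t ^ 2 - 2 * k₁) (b t * c t - a t) (c t ^ 2 - 2 * b t - 2 * k₂) y) t :=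
    (((hℓt t ht' _).add (hℓt t ht' _)).sub ((hmt t ht' z).const_mul 2)).sub
      (((((ha t ht').mul_const _).add (((hb t ht').const_mul 2).mul_const _)).add
        ((hc t ht').mul_const _)).const_mul _)
  have hD0 := deriv_nonpos_of_min_right hst hD fun r hr => hmin' r ⟨hr.1, hr.2.trans ht'.2⟩ z y
  have hcr := twoPoint_critical (hℓ t ht') (hm t ht') (hmin' t ht') h
  have := hsup t ht' (z + y)
  have := hsup t ht' (z - y)
  have := hh z y
  simp only [blockForm] at hD0 hcr
  linarith

lemma contDiff_nsq {k : WithTop ℕ∞} : ContDiff ℝ k (nsq : E n × E n → ℝ) := by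
  unfold nsq
  exact (contDiff_fst.norm_sq ℝ).add (contDiff_snd.norm_sq ℝ)

lemma coord_add (x y : E n × E n) (j : Fin n ⊕ Fin n) :
    coord (x + y) j = coord x j + coord y j := by
  rcases j with j | j <;> simp [coord]

lemma contDiff_coord {k : WithTop ℕ∞} (j : Fin n ⊕ Fin n) :
    ContDiff ℝ k fun p : E n × E n => coord p j := by
  rcases j with j | j
  · exact (EuclideanSpace.proj j : E n →L[ℝ] ℝ).contDiff.comp contDiff_fst
  · exact (EuclideanSpace.proj j : E n →L[ℝ] ℝ).contDiff.comp contDiff_snd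

lemma pd_coord (i j : Fin n ⊕ Fin n) :
    pd (fun p : E n × E n => coord p i) j = fun _ => if i = j then 1 else 0 := by
  ext p
  refine fderiv_eq_of_quadratic (b := 0) (differentiable_of_two (contDiff_coord i)) fun s => ?_
  rw [coord_add, coord_smul, coord_stdBasis]; ring

lemma pd_nsq (j : Fin n ⊕ Fin n) : pd (nsq : E n × E n → ℝ) j = fun p => 2 * coord p j := by
  ext p
  refine fderiv_eq_of_quadratic (b := 1) (differentiable_of_two contDiff_nsq) fun s => ?_
  simp only [nsq_eq_sum, coord_add, coord_smul, coord_stdBasis]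
  have : ∀ x : Fin n ⊕ Fin n, (coord p x + s * if x = j then 1 else 0) ^ 2 = coord p x ^ 2 +
      if x = j then s * (2 * coord p j) + s ^ 2 * 1 else 0 := by
    intro x; split_ifs with hx
    · subst hx; ring
    · ring
  simp only [this, Finset.sum_add_distrib, Finset.sum_ite_eq', Finset.mem_univ, if_true]
  ring

lemma abs_two_mul_sum_le (x y : E n) : |2 * ∑ i, x i * y i| ≤ ‖x‖ ^ 2 + ‖y‖ ^ 2 := by
  have : ∑ i, x i * y i = inner ℝ y x := by simp [PiLp.inner_apply]
  rw [this, abs_mul, abs_two]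
  nlinarith [abs_real_inner_le_norm y x, sq_nonneg (‖x‖ - ‖y‖)]

lemma contDiff_mul_one_add_nsq (A : ℝ) {k : WithTop ℕ∞} :
    ContDiff ℝ k fun p : E n × E n => A * (1 + nsq p) :=
  contDiff_const.mul (contDiff_const.add contDiff_nsq)

lemma logKineticOp_mul_one_add_nsq (h : E n × E n → ℝ) (A : ℝ) (p : E n × E n) :
    logKineticOp h (fun q => A * (1 + nsq q)) p =
      2 * A * n + 4 * A ^ 2 * ‖p.2‖ ^ 2 - A * (2 * ∑ i, p.2 i * p.1 i) + h p := by
  have e0 : Differentiable ℝ fun q : E n × E n => 1 + nsq q :=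
    differentiable_of_two (contDiff_const.add contDiff_nsq)
  have e1 : ∀ j, pd (fun q : E n × E n => A * (1 + nsq q)) j = fun p => (2 * A) * coord p j := by
    intro j
    rw [pd_const_mul e0, pd_fun_add (differentiable_const _) (differentiable_of_two contDiff_nsq),
      pd_nsq]
    ext q; simp [pd]; ring
  have e2 : ∀ j p, pd (fun p : E n × E n => (2 * A) * coord p j) j p = 2 * A := by
    intro j p
    rw [pd_const_mul (differentiable_of_two (contDiff_coord j)), pd_coord]; simp
  simp only [logKineticOp, lapV, e1, e2, Finset.sum_const, Finset.card_univ, Fintype.card_fin,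
    nsmul_eq_mul]
  simp only [coord, Sum.elim_inl, Sum.elim_inr, EuclideanSpace.norm_sq_eq, Real.norm_eq_abs,
    sq_abs, Finset.mul_sum]
  congr 2
  · congr 1
    · ring
    · exact Finset.sum_congr rfl fun i _ => by ring
  · exact Finset.sum_congr rfl fun i _ => by ring

/-- Growth rate for which `exp (A (1 + |z|²))` is a strict supersolution. -/
def barrierRate (n : ℕ) (C A₀ : ℝ) : ℝ := (2 * n + 1) * (A₀ + 1) + 4 * (A₀ + 1) ^ 2 + C + 1

lemma logKineticOp_barrier_lt {h : E n × E n → ℝ} {C A₀ A : ℝ} (hh : ∀ p, h p ≤ C * (1 + nsq p))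
    (hA₀ : 0 ≤ A) (hA : A ≤ A₀ + 1) (p : E n × E n) :
    logKineticOp h (fun q => A * (1 + nsq q)) p < barrierRate n C A₀ * (1 + nsq p) := by
  rw [logKineticOp_mul_one_add_nsq]
  have h1 := (abs_le.1 (abs_two_mul_sum_le p.2 p.1)).1
  have h2 : A * -(2 * ∑ i, p.2 i * p.1 i) ≤ A * nsq p :=
    mul_le_mul_of_nonneg_left (by unfold nsq; linarith) hA₀
  have h3 : ‖p.2‖ ^ 2 ≤ nsq p := by unfold nsq; nlinarith [sq_nonneg ‖p.1‖]
  have h4 := nsq_nonneg p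
  have h5 : A ^ 2 ≤ (A₀ + 1) ^ 2 := by gcongr
  have h6 : A ^ 2 * ‖p.2‖ ^ 2 ≤ (A₀ + 1) ^ 2 * nsq p := by gcongr
  have h7 : A * n ≤ (A₀ + 1) * n := by gcongr
  have h8 : A * nsq p ≤ (A₀ + 1) * nsq p := by gcongr
  have h9 : 0 ≤ (A₀ + 1) * n * nsq p := by
    have : 0 ≤ A₀ + 1 := hA₀.trans hA
    positivity
  have := hh p
  unfold barrierRate
  nlinarith [sq_nonneg (A₀ + 1)]

lemma contDiff_log_add {m φ : E n × E n → ℝ} {ε : ℝ} (hε : 0 < ε) (hm : ContDiff ℝ 2 m)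
    (hφ : ContDiff ℝ 2 φ) :
    ContDiff ℝ 2 fun q => Real.log (Real.exp (m q) + ε * Real.exp (φ q)) :=
  (hm.exp.add (contDiff_const.mul hφ.exp)).log fun q => by positivity

lemma logKineticOp_log_add {m φ : E n × E n → ℝ} {ε : ℝ} (hε : 0 < ε) (hm : ContDiff ℝ 2 m)
    (hφ : ContDiff ℝ 2 φ) (h : E n × E n → ℝ) (p : E n × E n) :
    logKineticOp h (fun q => Real.log (Real.exp (m q) + ε * Real.exp (φ q))) p =
      (Real.exp (m p) * logKineticOp h m p + ε * (Real.exp (φ p) * logKineticOp h φ p)) /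
        (Real.exp (m p) + ε * Real.exp (φ p)) := by
  have hpos : ∀ q, 0 < Real.exp (m q) + ε * Real.exp (φ q) := fun q => by positivity
  have h1 := kineticOp_exp (contDiff_log_add hε hm hφ) h p
  simp only [Real.exp_log (hpos _)] at h1
  rw [kineticOp_fun_add hm.exp (contDiff_const.mul hφ.exp), kineticOp_const_mul hφ.exp,
    kineticOp_exp hm, kineticOp_exp hφ] at h1
  rw [h1, mul_div_cancel_left₀ _ (hpos p).ne']

lemma nsq_add_add_nsq_sub (z y : E n × E n) :
    nsq (z + y) + nsq (z - y) = 2 * nsq z + 2 * nsq y := by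
  have h1 := parallelogram_law_with_norm ℝ z.1 y.1
  have h2 := parallelogram_law_with_norm ℝ z.2 y.2
  simp only [nsq, Prod.fst_add, Prod.snd_add, Prod.fst_sub, Prod.snd_sub]
  nlinarith

lemma blockForm_le (a b c : ℝ) (y : E n × E n) :
    blockForm a b c y ≤ (|a| + |b| + |c|) * nsq y := by
  have h1 : a * ‖y.1‖ ^ 2 ≤ |a| * nsq y := by
    unfold nsq
    exact mul_le_mul (le_abs_self a) (by nlinarith [sq_nonneg ‖y.2‖]) (sq_nonneg _) (abs_nonneg _)
  have h2 : c * ‖y.2‖ ^ 2 ≤ |c| * nsq y := by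
    unfold nsq
    exact mul_le_mul (le_abs_self c) (by nlinarith [sq_nonneg ‖y.1‖]) (sq_nonneg _) (abs_nonneg _)
  have h3 : 2 * b * inner ℝ y.1 y.2 ≤ |b| * nsq y := by
    refine (le_abs_self _).trans ?_
    rw [abs_mul, abs_mul, abs_two]
    have := abs_real_inner_le_norm y.1 y.2
    have h4 : 2 * |inner ℝ y.1 y.2| ≤ nsq y := by
      unfold nsq; nlinarith [sq_nonneg (‖y.1‖ - ‖y.2‖)]
    nlinarith [abs_nonneg b]
  unfold blockForm
  linarith

/-- Solutions of the matrix Riccati equation with diagonal forcing, blowing down at time `0`. -/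
structure RiccatiTriple (n : ℕ) (k₁ k₂ θ : ℝ) (a b c : ℝ → ℝ) : Prop where
  deriv_a : ∀ t ∈ Ioo 0 θ, HasDerivAt a (b t ^ 2 - 2 * k₁) t
  deriv_b : ∀ t ∈ Ioo 0 θ, HasDerivAt b (b t * c t - a t) t
  deriv_c : ∀ t ∈ Ioo 0 θ, HasDerivAt c (c t ^ 2 - 2 * b t - 2 * k₂) t
  blowdown : ∀ M : ℝ, ∃ δ > 0, ∀ t ∈ Ioo 0 δ, ∀ y : E n × E n,
    1 / 2 * blockForm (a t) (b t) (c t) y ≤ -M * nsq y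

lemma RiccatiTriple.exists_bound {k₁ k₂ θ : ℝ} {a b c : ℝ → ℝ} (hS : RiccatiTriple n k₁ k₂ θ a b c)
    {r : ℝ} (hr : r < θ) : ∃ s, 0 ≤ s ∧ ∀ t ∈ Ioc 0 r, ∀ y : E n × E n,
      1 / 2 * blockForm (a t) (b t) (c t) y ≤ s * nsq y := by
  obtain ⟨δ, hδ, h⟩ := hS.blowdown 0
  have hcont : ContinuousOn (fun t => |a t| + |b t| + |c t|) (Icc δ r) := by
    intro t ht
    have ht' : t ∈ Ioo 0 θ := ⟨hδ.trans_le ht.1, ht.2.trans_lt hr⟩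
    exact ((((hS.deriv_a t ht').continuousAt.abs.add (hS.deriv_b t ht').continuousAt.abs)).add
      (hS.deriv_c t ht').continuousAt.abs).continuousWithinAt
  obtain ⟨B, hB⟩ := isCompact_Icc.bddAbove_image hcont
  refine ⟨|B|, abs_nonneg _, fun t ht y => ?_⟩
  have hN := nsq_nonneg y
  rcases lt_or_ge t δ with htδ | htδ
  · have := h t ⟨ht.1, htδ⟩ y
    nlinarith [abs_nonneg B]
  · have h1 := hB (mem_image_of_mem _ (⟨htδ, ht.2⟩ : t ∈ Icc δ r))
    have h2 := blockForm_le (a t) (b t) (c t) y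
    have h3 : (|a t| + |b t| + |c t|) * nsq y ≤ |B| * nsq y :=
      mul_le_mul_of_nonneg_right (h1.trans (le_abs_self B)) hN
    nlinarith [abs_nonneg B]

/-- Logarithms of positive solutions of the kinetic equation on `(0, T)`, with at most quadratic
growth from above. -/
structure LogSolution (h : E n × E n → ℝ) (T : ℝ) (m : ℝ → E n × E n → ℝ) : Prop where
  contDiff : ∀ t ∈ Ioo 0 T, ContDiff ℝ 2 (m t)
  hasDerivAt : ∀ t ∈ Ioo 0 T, ∀ z, HasDerivAt (fun s => m s z) (logKineticOp h (m t) z) t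
  continuousOn : ContinuousOn (fun q : ℝ × (E n × E n) => m q.1 q.2) (Ioo 0 T ×ˢ univ)
  growth : ∀ τ ∈ Ioo 0 T, ∀ t ∈ Ioo 0 T, ∃ C, ∀ s ∈ Icc τ t, ∀ z, m s z ≤ C * (1 + nsq z)

/-- The midpoint inequality expressing `∇²m ≥ ½ [[a, b], [b, c]]`. -/
def MidpointBound (m : E n × E n → ℝ) (a b c : ℝ) : Prop :=
  ∀ z y, 0 ≤ twoPoint m m a b c z y

/-- The logarithm of `exp m` perturbed by `ε exp (A (1 + |z|²))`. -/
def perturbed (m : ℝ → E n × E n → ℝ) (A : ℝ → ℝ) (ε t : ℝ) (z : E n × E n) : ℝ :=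
  Real.log (Real.exp (m t z) + ε * Real.exp (A t * (1 + nsq z)))

lemma le_perturbed (m : ℝ → E n × E n → ℝ) (A : ℝ → ℝ) {ε : ℝ} (hε : 0 < ε) (t : ℝ)
    (z : E n × E n) : m t z ≤ perturbed m A ε t z := by
  unfold perturbed
  rw [Real.le_log_iff_exp_le (by positivity)]
  have : 0 < ε * Real.exp (A t * (1 + nsq z)) := by positivity
  linarith

lemma log_add_le_perturbed (m : ℝ → E n × E n → ℝ) (A : ℝ → ℝ) {ε : ℝ} (hε : 0 < ε) (t : ℝ)
    (z : E n × E n) : Real.log ε + A t * (1 + nsq z) ≤ perturbed m A ε t z := by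
  unfold perturbed
  rw [Real.le_log_iff_exp_le (by positivity), Real.exp_add, Real.exp_log hε]
  have := Real.exp_pos (m t z)
  linarith

lemma le_twoPoint_perturbed {m : ℝ → E n × E n → ℝ} {A : ℝ → ℝ} {ε t a b c C s : ℝ}
    (hC : 0 ≤ C) (hε : 0 < ε) (hm : ∀ z, m t z ≤ C * (1 + nsq z))
    (hs : ∀ y : E n × E n, 1 / 2 * blockForm a b c y ≤ s * nsq y) (hs0 : 0 ≤ s)
    (hA : C + 1 + s ≤ A t) (z y : E n × E n) :
    2 * Real.log ε + 2 * (nsq z + nsq y) ≤ twoPoint (perturbed m A ε t) (m t) a b c z y := by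
  have h1 := log_add_le_perturbed m A hε t (z + y)
  have h2 := log_add_le_perturbed m A hε t (z - y)
  have h3 := hm z
  have h4 := hs y
  have h5 := nsq_add_add_nsq_sub z y
  have hz := nsq_nonneg z
  have hy := nsq_nonneg y
  have h6 : (C + 1 + s) * (2 + (nsq (z + y) + nsq (z - y))) ≤
      A t * (2 + (nsq (z + y) + nsq (z - y))) :=
    mul_le_mul_of_nonneg_right hA (by rw [h5]; positivity)
  rw [h5] at h6
  have h7 : A t * (1 + nsq (z + y)) + A t * (1 + nsq (z - y)) =
        A t * (2 + (2 * nsq z + 2 * nsq y)) := by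
    rw [← h5]; ring
  unfold twoPoint
  nlinarith [mul_nonneg hC hz, mul_nonneg hC hy, mul_nonneg hs0 hy, mul_nonneg hs0 hz]

lemma continuousOn_perturbed {m : ℝ → E n × E n → ℝ} {A : ℝ → ℝ} {ε : ℝ} (hε : 0 < ε)
    {s : Set ℝ} (hm : ContinuousOn (fun q : ℝ × (E n × E n) => m q.1 q.2) (s ×ˢ univ))
    (hA : Continuous A) :
    ContinuousOn (fun q : ℝ × (E n × E n) => perturbed m A ε q.1 q.2) (s ×ˢ univ) := by
  unfold perturbed
  refine ContinuousOn.log ?_ fun q _ => by positivity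
  have hN : Continuous (nsq : E n × E n → ℝ) := (contDiff_nsq (k := 0)).continuous
  have : Continuous fun q : ℝ × (E n × E n) => ε * Real.exp (A q.1 * (1 + nsq q.2)) := by fun_prop
  exact hm.rexp.add this.continuousOn

lemma continuousOn_twoPoint {m ℓ : ℝ → E n × E n → ℝ} {a b c : ℝ → ℝ} {s : Set ℝ}
    (hm : ContinuousOn (fun q : ℝ × (E n × E n) => m q.1 q.2) (s ×ˢ univ))
    (hℓ : ContinuousOn (fun q : ℝ × (E n × E n) => ℓ q.1 q.2) (s ×ˢ univ))
    (ha : ContinuousOn a s) (hb : ContinuousOn b s) (hc : ContinuousOn c s) :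
    ContinuousOn (fun q : ℝ × ((E n × E n) × (E n × E n)) =>
      twoPoint (ℓ q.1) (m q.1) (a q.1) (b q.1) (c q.1) q.2.1 q.2.2) (s ×ˢ univ) := by
  have hfst : MapsTo (Prod.fst : ℝ × ((E n × E n) × (E n × E n)) → ℝ) (s ×ˢ univ) s :=
    fun q hq => hq.1
  have comp : ∀ {f : ℝ → E n × E n → ℝ} (g : (E n × E n) × (E n × E n) → E n × E n), Continuous g →
      ContinuousOn (fun q : ℝ × (E n × E n) => f q.1 q.2) (s ×ˢ univ) →
      ContinuousOn (fun q : ℝ × ((E n × E n) × (E n × E n)) => f q.1 (g q.2)) (s ×ˢ univ) := by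
    intro f g hg hf
    exact hf.comp (f := fun q : ℝ × ((E n × E n) × (E n × E n)) => (q.1, g q.2))
      (by fun_prop) fun q hq => ⟨hq.1, trivial⟩
  have ha' := ha.comp continuousOn_fst hfst
  have hb' := hb.comp continuousOn_fst hfst
  have hc' := hc.comp continuousOn_fst hfst
  unfold twoPoint blockForm
  refine (((comp (fun q => q.1 + q.2) (by fun_prop) hℓ).add
    (comp (fun q => q.1 - q.2) (by fun_prop) hℓ)).sub
    (continuousOn_const.mul (comp (fun q => q.1) (by fun_prop) hm))).sub
    (continuousOn_const.mul (((ha'.mul ?_).add ((continuousOn_const.mul hb').mul ?_)).add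
      (hc'.mul ?_)))
  all_goals exact Continuous.continuousOn (by fun_prop)

section propagation

variable {h : E n × E n → ℝ} {m : ℝ → E n × E n → ℝ} {a b c : ℝ → ℝ} {T k₁ k₂ θ τ te C C_h s : ℝ}

/-- Nonnegativity of the perturbed two-point quantity persists for a short time. -/
lemma LogSolution.twoPoint_perturbed_nonneg (hsol : LogSolution h T m)
    (hmid : ∀ z y, -k₁ * ‖y.1‖ ^ 2 - k₂ * ‖y.2‖ ^ 2 ≤ h (z + y) + h (z - y) - 2 * h z)
    (hup : ∀ p, h p ≤ C_h * (1 + nsq p)) (hCh : 0 ≤ C_h)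
    (hS : RiccatiTriple n k₁ k₂ θ a b c) (hτ : 0 < τ) (hte : te < T) (hθ : te - τ < θ)
    (hC : 0 ≤ C) (hm : ∀ t ∈ Icc τ te, ∀ z, m t z ≤ C * (1 + nsq z)) (hs0 : 0 ≤ s)
    (hs : ∀ t ∈ Ioc 0 (te - τ), ∀ y : E n × E n, 1 / 2 * blockForm (a t) (b t) (c t) y ≤ s * nsq y)
    {t₁ s₀ t₂ ε Γ : ℝ} (hΓ : Γ = barrierRate n C_h (C + 1 + s)) (h₁ : t₁ ≤ s₀) (h₀ : τ < s₀)
    (h₂ : t₂ ≤ te) (hδ : t₂ ≤ t₁ + 1 / Γ) (hε : 0 < ε)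
    (hinit : ∀ z y, 0 ≤ twoPoint (perturbed m (fun t => C + 1 + s + Γ * (t - t₁)) ε s₀) (m s₀)
      (a (s₀ - τ)) (b (s₀ - τ)) (c (s₀ - τ)) z y) :
    ∀ t ∈ Icc s₀ t₂, ∀ z y, 0 ≤ twoPoint (perturbed m (fun t => C + 1 + s + Γ * (t - t₁)) ε t) (m t)
      (a (t - τ)) (b (t - τ)) (c (t - τ)) z y := by
  set A : ℝ → ℝ := fun t => C + 1 + s + Γ * (t - t₁) with hA
  have hΓ0 : 0 < Γ := by rw [hΓ, barrierRate]; positivity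
  have hT : ∀ t ∈ Icc s₀ t₂, t ∈ Ioo 0 T := fun t ht =>
    ⟨by linarith [ht.1], by linarith [ht.2]⟩
  have hθ' : ∀ t ∈ Icc s₀ t₂, t - τ ∈ Ioo 0 θ := fun t ht =>
    ⟨by linarith [ht.1], by linarith [ht.2]⟩
  have hA0 : ∀ t ∈ Icc s₀ t₂, C + 1 + s ≤ A t := fun t ht => by
    have : 0 ≤ Γ * (t - t₁) := mul_nonneg hΓ0.le (by linarith [ht.1])
    simp only [hA]; linarith
  have hA1 : ∀ t ∈ Icc s₀ t₂, A t ≤ C + 1 + s + 1 := fun t ht => by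
    have : Γ * (t - t₁) ≤ Γ * (1 / Γ) := by
      refine mul_le_mul_of_nonneg_left ?_ hΓ0.le
      linarith [ht.2]
    rw [mul_one_div_cancel hΓ0.ne'] at this
    simp only [hA]; linarith
  have hAd : ∀ t, HasDerivAt A Γ t := fun t => by
    exact ((((hasDerivAt_id t).sub_const t₁).const_mul Γ).const_add (C + 1 + s)).congr_deriv
      (mul_one Γ)
  have hAc : Continuous A := by fun_prop
  have hda := fun t ht => (hS.deriv_a _ (hθ' t ht)).comp_sub_const t τ
  have hdb := fun t ht => (hS.deriv_b _ (hθ' t ht)).comp_sub_const t τ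
  have hdc := fun t ht => (hS.deriv_c _ (hθ' t ht)).comp_sub_const t τ
  have hmc := hsol.continuousOn.mono (prod_mono_left (t := univ) hT)
  have hcont := continuousOn_twoPoint (ℓ := perturbed m A ε) (a := fun t => a (t - τ))
    (b := fun t => b (t - τ)) (c := fun t => c (t - τ)) hmc (continuousOn_perturbed hε hmc hAc)
    (fun t ht => (hda t ht).continuousAt.continuousWithinAt)
    (fun t ht => (hdb t ht).continuousAt.continuousWithinAt)
    (fun t ht => (hdc t ht).continuousAt.continuousWithinAt)
  refine twoPoint_nonneg (ℓ := perturbed m A ε) (m := m) (R := -Real.log ε)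
    (a := fun t => a (t - τ)) (b := fun t => b (t - τ)) (c := fun t => c (t - τ))
    (ℓ' := fun t z => (Real.exp (m t z) * logKineticOp h (m t) z +
      ε * (Real.exp (A t * (1 + nsq z)) * (Γ * (1 + nsq z)))) /
      (Real.exp (m t z) + ε * Real.exp (A t * (1 + nsq z))))
    hmid (fun t ht => hsol.contDiff t (hT t ht))
    (fun t ht => contDiff_log_add hε (hsol.contDiff t (hT t ht)) (contDiff_mul_one_add_nsq (A t)))
    (fun t ht => hsol.hasDerivAt t (hT t ht)) ?_ ?_ hda hdb hdc hcont ?_ hinit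
  · intro t ht z
    refine HasDerivAt.log ((hsol.hasDerivAt t (hT t ht) z).exp.add
      ((((hAd t).mul_const (1 + nsq z)).exp).const_mul ε)) (by positivity)
  · intro t ht z
    have e := logKineticOp_log_add hε (hsol.contDiff t (hT t ht))
      (contDiff_mul_one_add_nsq (A t)) h z
    change logKineticOp h
      (fun q => Real.log (Real.exp (m t q) + ε * Real.exp (A t * (1 + nsq q)))) z < _
    rw [e]
    have := logKineticOp_barrier_lt (A₀ := C + 1 + s) hup (by linarith [hA0 t ht]) (hA1 t ht) z
    rw [← hΓ] at this
    refine div_lt_div_of_pos_right ?_ (by positivity)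
    gcongr
  · intro t ht z y hR
    have := le_twoPoint_perturbed (A := A) (ε := ε) (t := t) hC hε
      (hm t ⟨by linarith [ht.1], by linarith [ht.2]⟩)
      (hs (t - τ) ⟨by linarith [ht.1], by linarith [ht.2]⟩) hs0 (hA0 t ht) z y
    linarith

lemma twoPoint_mono {ℓ ℓ' m : E n × E n → ℝ} (h : ∀ z, ℓ z ≤ ℓ' z) (a b c : ℝ) (z y : E n × E n) :
    twoPoint ℓ m a b c z y ≤ twoPoint ℓ' m a b c z y := by
  unfold twoPoint; linarith [h (z + y), h (z - y)]

lemma midpointBound_of_perturbed {A : ℝ → ℝ} {t a b c : ℝ}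
    (H : ∀ ε > 0, ∀ z y, 0 ≤ twoPoint (perturbed m A ε t) (m t) a b c z y) :
    MidpointBound (m t) a b c := by
  intro z y
  have hc : ∀ q, Filter.Tendsto (fun ε => perturbed m A ε t q)
      (nhdsWithin 0 (Ioi 0)) (nhds (m t q)) := by
    intro q
    have : ContinuousAt (fun ε => perturbed m A ε t q) 0 := by
      unfold perturbed
      exact ContinuousAt.log (by fun_prop) (by positivity)
    have h0 : perturbed m A 0 t q = m t q := by simp [perturbed]
    rw [ContinuousAt, h0] at this
    exact this.mono_left nhdsWithin_le_nhds
  refine ge_of_tendsto (((hc (z + y)).add (hc (z - y))).sub_const _ |>.sub_const _) ?_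
  filter_upwards [self_mem_nhdsWithin] with ε hε
  exact H ε hε z y

end propagation

lemma isCompact_nsq_le (R : ℝ) : IsCompact {q : E n × E n | nsq q ≤ R} := by
  convert (isCompact_nsq_add_le (n := n) R).image continuous_fst using 1
  ext q
  constructor
  · exact fun h => ⟨(q, 0), by simpa [nsq] using h, rfl⟩
  · rintro ⟨⟨_, y⟩, h, rfl⟩
    simp only [mem_ofPred_eq] at h ⊢
    linarith [nsq_nonneg y]

lemma norm_lt_of_nsq_lt {y : E n × E n} {r : ℝ} (hr : 0 < r) (h : nsq y < r ^ 2) : ‖y‖ < r := by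
  unfold nsq at h
  rw [Prod.norm_def, max_lt_iff]
  exact ⟨lt_of_pow_lt_pow_left₀ 2 hr.le (by nlinarith [sq_nonneg ‖y.2‖]),
    lt_of_pow_lt_pow_left₀ 2 hr.le (by nlinarith [sq_nonneg ‖y.1‖])⟩

section midpoint

variable {h : E n × E n → ℝ} {m : ℝ → E n × E n → ℝ} {a b c : ℝ → ℝ} {T k₁ k₂ θ τ te C C_h s : ℝ}

lemma LogSolution.eventually_twoPoint_perturbed_nonneg (hsol : LogSolution h T m)
    (hS : RiccatiTriple n k₁ k₂ θ a b c) (hτ : 0 < τ) (hte : te < T)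
    (hC : 0 ≤ C) (hm : ∀ t ∈ Icc τ te, ∀ z, m t z ≤ C * (1 + nsq z)) (hs0 : 0 ≤ s)
    (hs : ∀ t ∈ Ioc 0 (te - τ), ∀ y : E n × E n, 1 / 2 * blockForm (a t) (b t) (c t) y ≤ s * nsq y)
    {A : ℝ → ℝ} (hA : ∀ t ∈ Icc τ te, C + 1 + s ≤ A t) {ε : ℝ} (hε : 0 < ε) :
    ∃ δ > 0, ∀ t ∈ Ioo τ (τ + δ), t ≤ te → ∀ z y,
      0 ≤ twoPoint (perturbed m A ε t) (m t) (a (t - τ)) (b (t - τ)) (c (t - τ)) z y := by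
  set K : Set (ℝ × (E n × E n)) := Icc τ te ×ˢ {q : E n × E n | nsq q ≤ 2 * |Real.log ε|} with hK
  have hKc : IsCompact K := isCompact_Icc.prod (isCompact_nsq_le _)
  have hmK : ContinuousOn (fun q : ℝ × (E n × E n) => m q.1 q.2) K :=
    hsol.continuousOn.mono (prod_mono (fun t ht => ⟨hτ.trans_le ht.1, ht.2.trans_lt hte⟩)
      (subset_univ _))
  obtain ⟨r, hr, huc⟩ := Metric.uniformContinuousOn_iff.1
    (hKc.uniformContinuousOn_of_continuous hmK.rexp) ε hε
  obtain ⟨B, hB⟩ := hKc.exists_bound_of_continuousOn hmK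
  obtain ⟨δ, hδ, hbd⟩ := hS.blowdown (4 * |B| / r ^ 2)
  refine ⟨δ, hδ, fun t ht hte' z y => ?_⟩
  have ht' : t ∈ Icc τ te := ⟨ht.1.le, hte'⟩
  have hz := nsq_nonneg z
  have hy := nsq_nonneg y
  have hS' := hbd (t - τ) ⟨by linarith [ht.1], by linarith [ht.2]⟩ y
  by_cases hR : nsq z + nsq y ≤ |Real.log ε|
  · have hN := nsq_add_add_nsq_sub z y
    have hp := nsq_nonneg (z + y)
    have hq := nsq_nonneg (z - y)
    have m0 : (t, z) ∈ K := ⟨ht', by simp only [mem_ofPred_eq]; linarith⟩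
    have m1 : (t, z + y) ∈ K := ⟨ht', by simp only [mem_ofPred_eq]; linarith⟩
    have m2 : (t, z - y) ∈ K := ⟨ht', by simp only [mem_ofPred_eq]; linarith⟩
    rcases lt_or_ge (nsq y) (r ^ 2) with hyr | hyr
    · have key : ∀ w, (t, w) ∈ K → dist w z < r → m t z ≤ perturbed m A ε t w := by
        intro w hw hd
        have h1 := huc _ hw _ m0 (by simpa [Prod.dist_eq, hr] using hd)
        rw [Real.dist_eq] at h1
        have h2 := (abs_lt.1 h1).1
        have h3 : 0 ≤ A t * (1 + nsq w) :=
          mul_nonneg (by linarith [hA t ht']) (by linarith [nsq_nonneg w])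
        unfold perturbed
        rw [Real.le_log_iff_exp_le (by positivity)]
        have := mul_le_mul_of_nonneg_left (Real.one_le_exp h3) hε.le
        simp only at h2
        linarith
      have hy' := norm_lt_of_nsq_lt hr hyr
      have h1 := key _ m1 (by simpa [dist_eq_norm] using hy')
      have h2 := key _ m2 (by simpa [dist_eq_norm] using hy')
      have h3 : 0 ≤ 4 * |B| / r ^ 2 * nsq y := by positivity
      unfold twoPoint
      linarith
    · refine le_trans ?_ (twoPoint_mono (le_perturbed m A hε t) _ _ _ z y)
      have h0 := abs_le.1 ((hB _ m0).trans (le_abs_self B))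
      have h1 := abs_le.1 ((hB _ m1).trans (le_abs_self B))
      have h2 := abs_le.1 ((hB _ m2).trans (le_abs_self B))
      have h3 : 4 * |B| ≤ 4 * |B| / r ^ 2 * nsq y := by
        rw [div_mul_eq_mul_div, le_div_iff₀ (by positivity)]
        exact mul_le_mul_of_nonneg_left hyr (by positivity)
      simp only at h0 h1 h2
      unfold twoPoint
      linarith
  · have h1 := le_twoPoint_perturbed (A := A) (ε := ε) (t := t) hC hε (hm t ht')
      (hs (t - τ) ⟨by linarith [ht.1], by linarith⟩) hs0 (hA t ht') z y
    have := neg_abs_le (Real.log ε)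
    linarith [not_le.1 hR]

lemma LogSolution.midpointBound_shift (hsol : LogSolution h T m)
    (hmid : ∀ z y, -k₁ * ‖y.1‖ ^ 2 - k₂ * ‖y.2‖ ^ 2 ≤ h (z + y) + h (z - y) - 2 * h z)
    (hup : ∀ p, h p ≤ C_h * (1 + nsq p)) (hCh : 0 ≤ C_h)
    (hS : RiccatiTriple n k₁ k₂ θ a b c) (hτ : 0 < τ) (hτt : τ < te) (hte : te < T)
    (hθ : te - τ < θ) : MidpointBound (m te) (a (te - τ)) (b (te - τ)) (c (te - τ)) := by
  obtain ⟨C, hm⟩ := hsol.growth τ ⟨hτ, hτt.trans hte⟩ te ⟨hτ.trans hτt, hte⟩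
  replace hm : ∀ t ∈ Icc τ te, ∀ z, m t z ≤ |C| * (1 + nsq z) := fun t ht z =>
    (hm t ht z).trans (mul_le_mul_of_nonneg_right (le_abs_self C) (by linarith [nsq_nonneg z]))
  obtain ⟨s, hs0, hs⟩ := hS.exists_bound hθ
  have hC := abs_nonneg C
  set Γ := barrierRate n C_h (|C| + 1 + s) with hΓ
  have hΓ0 : 0 < Γ := by rw [hΓ, barrierRate]; positivity
  have hstep := fun {t₁ s₀ t₂ ε : ℝ} =>
    hsol.twoPoint_perturbed_nonneg hmid hup hCh hS hτ hte hθ hC hm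
    hs0 hs (t₁ := t₁) (s₀ := s₀) (t₂ := t₂) (ε := ε) hΓ
  have hstart : ∀ t ∈ Ioc τ te, t ≤ τ + 1 / Γ →
      MidpointBound (m t) (a (t - τ)) (b (t - τ)) (c (t - τ)) := by
    intro t ht htδ
    refine midpointBound_of_perturbed (A := fun t => |C| + 1 + s + Γ * (t - τ)) fun ε hε => ?_
    obtain ⟨δ, hδ, hinit⟩ := hsol.eventually_twoPoint_perturbed_nonneg hS hτ hte hC hm hs0 hs
      (A := fun t => |C| + 1 + s + Γ * (t - τ))
      (fun t ht => le_add_of_nonneg_right (mul_nonneg hΓ0.le (by linarith [ht.1]))) hε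
    obtain ⟨s₀, h1, h2⟩ := exists_between (lt_min ht.1 (lt_add_of_pos_right τ hδ))
    have h3 := (lt_min_iff.1 h2).1
    exact hstep h1.le h1 ht.2 htδ hε
      (hinit s₀ ⟨h1, (lt_min_iff.1 h2).2⟩ (h3.le.trans ht.2)) t ⟨h3.le, le_rfl⟩
  have hprop : ∀ t₁ ∈ Ioo τ te, MidpointBound (m t₁) (a (t₁ - τ)) (b (t₁ - τ)) (c (t₁ - τ)) →
      ∀ t ∈ Icc t₁ te, t ≤ t₁ + 1 / Γ →
        MidpointBound (m t) (a (t - τ)) (b (t - τ)) (c (t - τ)) := by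
    intro t₁ ht₁ hM t ht htδ
    refine midpointBound_of_perturbed (A := fun t => |C| + 1 + s + Γ * (t - t₁)) fun ε hε => ?_
    exact hstep le_rfl ht₁.1 ht.2 htδ hε
      (fun z y => (hM z y).trans (twoPoint_mono (le_perturbed m _ hε t₁) _ _ _ z y)) t
      ⟨ht.1, le_rfl⟩
  have hind : ∀ k : ℕ, ∀ t ∈ Ioc τ te, t ≤ τ + k * (1 / Γ) →
      MidpointBound (m t) (a (t - τ)) (b (t - τ)) (c (t - τ)) := by
    intro k
    induction k with
    | zero => intro t ht h0; simp at h0; exact absurd ht.1 (not_lt.2 h0)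
    | succ k ih =>
      intro t ht hk
      have hpos : 0 < 1 / Γ := by positivity
      by_cases h1 : t ≤ τ + 1 / Γ
      · exact hstart t ht h1
      · rw [not_le] at h1
        push_cast at hk
        have ht₁ : t - 1 / Γ ∈ Ioo τ te := ⟨by linarith, by linarith [ht.2]⟩
        exact hprop _ ht₁ (ih _ ⟨ht₁.1, ht₁.2.le⟩ (by linarith)) t ⟨by linarith, ht.2⟩ (by linarith)
  obtain ⟨k, hk⟩ := exists_nat_ge ((te - τ) / (1 / Γ))
  rw [div_le_iff₀ (by positivity)] at hk
  exact hind k te ⟨hτt, le_rfl⟩ (by linarith)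

/-- Matrix Harnack comparison with a Riccati solution, in midpoint form. -/
theorem LogSolution.midpointBound (hsol : LogSolution h T m)
    (hmid : ∀ z y, -k₁ * ‖y.1‖ ^ 2 - k₂ * ‖y.2‖ ^ 2 ≤ h (z + y) + h (z - y) - 2 * h z)
    (hup : ∀ p, h p ≤ C_h * (1 + nsq p)) (hCh : 0 ≤ C_h)
    (hS : RiccatiTriple n k₁ k₂ θ a b c) {t : ℝ} (ht : t ∈ Ioo 0 T) (htθ : t < θ) :
    MidpointBound (m t) (a t) (b t) (c t) := by
  intro z y
  have hlim : Filter.Tendsto (fun τ : ℝ => t - τ) (nhdsWithin 0 (Ioi 0)) (nhds t) := by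
    have : Continuous fun τ : ℝ => t - τ := by fun_prop
    exact (this.tendsto' 0 t (by simp)).mono_left nhdsWithin_le_nhds
  have ha := (hS.deriv_a t ⟨ht.1, htθ⟩).continuousAt.tendsto.comp hlim
  have hb := (hS.deriv_b t ⟨ht.1, htθ⟩).continuousAt.tendsto.comp hlim
  have hc := (hS.deriv_c t ⟨ht.1, htθ⟩).continuousAt.tendsto.comp hlim
  have hF : Filter.Tendsto (fun τ => twoPoint (m t) (m t) (a (t - τ)) (b (t - τ)) (c (t - τ)) z y)
      (nhdsWithin 0 (Ioi 0)) (nhds (twoPoint (m t) (m t) (a t) (b t) (c t) z y)) :=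
    tendsto_const_nhds.sub (tendsto_const_nhds.mul
      (((ha.mul_const _).add ((hb.const_mul 2).mul_const _)).add (hc.mul_const _)))
  refine ge_of_tendsto hF ?_
  filter_upwards [Ioo_mem_nhdsGT ht.1] with τ hτ
  exact hsol.midpointBound_shift hmid hup hCh hS hτ.1 hτ.2 ht.2 (by linarith [hτ.1]) z y

end midpoint

/-- Comparison of a stationary positive solution with a compactly supported strict subsolution. -/
lemma le_exp_of_subsolution {h φ : E n × E n → ℝ} {q q' : ℝ → E n × E n → ℝ} {t₀ t₁ c R : ℝ}
    (hφ : ContDiff ℝ 2 φ) (hsol : ∀ p, logKineticOp h φ p = 0) (hc : 0 ≤ c)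
    (hlow : ∀ p, nsq p ≤ R → -c ≤ h p)
    (hq : ∀ t ∈ Icc t₀ t₁, ContDiff ℝ 2 (q t))
    (hqt : ∀ t ∈ Icc t₀ t₁, ∀ z, HasDerivAt (fun s => q s z) (q' t z) t)
    (hcont : ContinuousOn (fun s : ℝ × (E n × E n) => q s.1 s.2) (Icc t₀ t₁ ×ˢ univ))
    (hsub : ∀ t ∈ Icc t₀ t₁, ∀ z, 0 < q t z → q' t z < kineticOp (fun _ => -c) (q t) z)
    (hsupp : ∀ t ∈ Icc t₀ t₁, ∀ z, 0 < q t z → nsq z ≤ R)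
    (hinit : ∀ z, q t₀ z ≤ Real.exp (φ z)) :
    ∀ t ∈ Icc t₀ t₁, ∀ z, q t z ≤ Real.exp (φ z) := by
  by_contra! hneg
  obtain ⟨t, ht, z, hlt⟩ := hneg
  have hmem : ∀ t ∈ Icc t₀ t₁, ∀ z, Real.exp (φ z) < q t z →
      (t, z) ∈ Icc t₀ t₁ ×ˢ {p : E n × E n | nsq p ≤ R} := fun t ht z hlt =>
    ⟨ht, hsupp t ht z ((Real.exp_pos _).trans hlt)⟩
  have hW : ContinuousOn (fun s : ℝ × (E n × E n) => Real.exp (φ s.2) - q s.1 s.2)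
      (Icc t₀ t₁ ×ˢ {p : E n × E n | nsq p ≤ R}) := by
    have := hφ.continuous
    exact (Continuous.continuousOn (by fun_prop)).sub
      (hcont.mono (prod_mono_right (subset_univ _)))
  obtain ⟨⟨t, z⟩, ⟨ht', -⟩, hmin⟩ := (isCompact_Icc.prod (isCompact_nsq_le R)).exists_isMinOn
    ⟨_, hmem t ht z hlt⟩ hW
  have hlt' : Real.exp (φ z) < q t z := by
    have := hmin (hmem _ ht _ hlt)
    simp only [mem_ofPred_eq] at this
    linarith
  simp only at ht'
  have hmin' : ∀ t' ∈ Icc t₀ t₁, ∀ z',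
      Real.exp (φ z) - q t z ≤ Real.exp (φ z') - q t' z' := by
    intro t' ht' z'
    by_cases hc' : Real.exp (φ z') < q t' z'
    · exact hmin (hmem _ ht' _ hc')
    · linarith
  have hpos := (Real.exp_pos (φ z)).trans hlt'
  have hst : t₀ < t := by
    refine lt_of_le_of_ne ht'.1 ?_
    rintro rfl
    exact absurd (hinit z) (not_le.2 hlt')
  have hD := deriv_nonpos_of_min_right hst ((hqt t ht' z).const_sub (Real.exp (φ z)))
    fun r hr => hmin' r ⟨hr.1, hr.2.trans ht'.2⟩ z
  have c2 : ContDiff ℝ 2 fun p => (-1) * q t p := contDiff_const.mul (hq t ht')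
  have hl : IsLocalMin (fun p => Real.exp (φ p) + (-1) * q t p) z :=
    Filter.Eventually.of_forall fun p => by have := hmin' t ht' p; linarith
  have h1 := lapV_nonneg_of_isLocalMin (hφ.exp.add c2) hl
  have h2 := kineticOp_fun_add hφ.exp c2 h z
  rw [kineticOp_exp hφ, hsol, kineticOp_const_mul (hq t ht')] at h2
  simp only [kineticOp, pd_eq_zero_of_isLocalMin hl] at h2
  have h3 := hsub t ht' z hpos
  have h4 := hlow z (hsupp t ht' z hpos)
  simp only [kineticOp] at h3
  simp only [mul_zero, Finset.sum_const_zero] at h2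
  have h5 := Real.exp_pos (φ z)
  nlinarith [mul_nonneg (by linarith : 0 ≤ h z + c) h5.le,
    mul_nonneg hc (by linarith : 0 ≤ q t z - Real.exp (φ z))]

lemma contDiff_blockForm (a b c k : ℝ) (z₀ : E n × E n) {N : WithTop ℕ∞} :
    ContDiff ℝ N fun z => k + blockForm a b c (z - z₀) := by
  have hx : ContDiff ℝ N fun z : E n × E n => (z - z₀).1 := (contDiff_id.sub contDiff_const).fst
  have hv : ContDiff ℝ N fun z : E n × E n => (z - z₀).2 := (contDiff_id.sub contDiff_const).snd
  exact contDiff_const.add (((contDiff_const.mul (hx.norm_sq ℝ)).add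
    (contDiff_const.mul (hx.inner ℝ hv))).add (contDiff_const.mul (hv.norm_sq ℝ)))

lemma pd_blockForm_inl (a b c k : ℝ) (z₀ : E n × E n) (i : Fin n) :
    pd (fun z => k + blockForm a b c (z - z₀)) (Sum.inl i) =
      fun z => 2 * (a * (z - z₀).1 i + b * (z - z₀).2 i) := by
  ext z
  refine fderiv_eq_of_quadratic (b := a) (differentiable_of_two (contDiff_blockForm ..))
    fun s => ?_
  rw [add_sub_right_comm z, blockForm_add_smul_inl]
  ring

lemma pd_blockForm_inr (a b c k : ℝ) (z₀ : E n × E n) (i : Fin n) :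
    pd (fun z => k + blockForm a b c (z - z₀)) (Sum.inr i) =
      fun z => 2 * (b * (z - z₀).1 i + c * (z - z₀).2 i) := by
  ext z
  refine fderiv_eq_of_quadratic (b := c) (differentiable_of_two (contDiff_blockForm ..))
    fun s => ?_
  rw [add_sub_right_comm z, blockForm_add_smul_inr]
  ring

lemma lapV_blockForm (a b c k : ℝ) (z₀ z : E n × E n) :
    lapV (fun z => k + blockForm a b c (z - z₀)) z = 2 * c * n := by
  have e : ∀ i, pd (fun z => 2 * (b * (z - z₀).1 i + c * (z - z₀).2 i)) (Sum.inr i) z = 2 * c := by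
    intro i
    refine fderiv_eq_of_quadratic (b := 0) ?_ fun s => ?_
    · fun_prop
    · simp [_root_.stdBasis]; ring
  simp only [lapV, pd_blockForm_inr, e, Finset.sum_const, Finset.card_univ, Fintype.card_fin,
    nsmul_eq_mul]
  ring

lemma logKineticOp_blockForm (h : E n × E n → ℝ) (a b c k : ℝ) (z₀ z : E n × E n) :
    logKineticOp h (fun z => k + blockForm a b c (z - z₀)) z =
      2 * c * n + blockForm (4 * b ^ 2) (4 * b * c - a) (4 * c ^ 2 - 2 * b) (z - z₀)
        - (2 * a * inner ℝ z₀.2 (z - z₀).1 + 2 * b * inner ℝ z₀.2 (z - z₀).2) + h z := by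
  simp only [logKineticOp, lapV_blockForm, pd_blockForm_inl, pd_blockForm_inr]
  simp only [blockForm_eq_sum, PiLp.inner_apply, RCLike.inner_apply, conj_trivial, Finset.mul_sum]
  have : ∀ A B D F G K : ℝ, B - D = F - G → A = K → A + B - D + h z = K + F - G + h z := by
    intros; linarith
  refine this _ _ _ _ _ _ ?_ (by ring)
  simp only [← Finset.sum_add_distrib, ← Finset.sum_sub_distrib]
  refine Finset.sum_congr rfl fun i _ => ?_
  simp only [Prod.fst_sub, Prod.snd_sub, PiLp.sub_apply]
  ring

/-- The trajectory of free transport issued from `z₁` at time `t₀`. -/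
def transported (z₁ : E n × E n) (t₀ t : ℝ) : E n × E n := (z₁.1 + (t - t₀) • z₁.2, z₁.2)

/-- Logarithm of the (unnormalised) Kolmogorov kernel centred at `transported z₁ t₀ t`. -/
def kolmogorovLog (z₁ : E n × E n) (t₀ t : ℝ) (z : E n × E n) : ℝ :=
  -(2 * n * Real.log t) +
    blockForm (-3 / t ^ 3) (3 / (2 * t ^ 2)) (-1 / t) (z - transported z₁ t₀ t)

lemma contDiff_kolmogorovLog (z₁ : E n × E n) (t₀ t : ℝ) :
    ContDiff ℝ 2 (kolmogorovLog z₁ t₀ t) :=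
  contDiff_blockForm ..

lemma hasDerivAt_kolmogorovLog (z₁ : E n × E n) (t₀ : ℝ) {t : ℝ} (ht : 0 < t) (c : ℝ)
    (z : E n × E n) :
    HasDerivAt (fun s => kolmogorovLog z₁ t₀ s z)
      (logKineticOp (fun _ => -c) (kolmogorovLog z₁ t₀ t) z + c) t := by
  have hX : HasDerivAt (fun s => z.1 - (z₁.1 + (s - t₀) • z₁.2)) (-z₁.2) t := by
    have := ((((hasDerivAt_id t).sub_const t₀).smul_const z₁.2).const_add z₁.1).const_sub z.1
    exact this.congr_deriv (by simp)
  have hV : HasDerivAt (fun _ : ℝ => z.2 - z₁.2) 0 t := hasDerivAt_const _ _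
  have ha : HasDerivAt (fun s : ℝ => -3 / s ^ 3) (9 / t ^ 4) t :=
    ((hasDerivAt_const t (-3:ℝ)).div (hasDerivAt_pow 3 t) (by positivity)).congr_deriv
      (by field_simp; norm_num; ring)
  have hb : HasDerivAt (fun s : ℝ => 3 / (2 * s ^ 2)) (-3 / t ^ 3) t :=
    ((hasDerivAt_const t (3:ℝ)).div ((hasDerivAt_pow 2 t).const_mul 2) (by positivity)).congr_deriv
      (by field_simp; norm_num; ring)
  have hc : HasDerivAt (fun s : ℝ => -1 / s) (1 / t ^ 2) t :=
    ((hasDerivAt_const t (-1:ℝ)).div (hasDerivAt_id t) ht.ne').congr_deriv (by simp)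
  have hl := ((Real.hasDerivAt_log ht.ne').const_mul (2 * (n:ℝ))).neg
  have := hl.add (((ha.mul hX.norm_sq).add ((hb.const_mul 2).mul (hX.inner ℝ hV))).add
    (hc.mul hV.norm_sq))
  refine this.congr_deriv ?_
  have e := logKineticOp_blockForm (fun _ => -c) (-3 / t ^ 3) (3 / (2 * t ^ 2)) (-1 / t)
    (-(2 * n * Real.log t)) (transported z₁ t₀ t) z
  unfold kolmogorovLog
  rw [e]
  simp only [blockForm, transported, Prod.fst_sub, Prod.snd_sub, inner_neg_right, inner_neg_left,
    inner_zero_right, real_inner_comm z₁.2]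
  field_simp
  ring

lemma inner_bounds (x y : E n) (s : ℝ) : 0 ≤ ‖x‖ ^ 2 + 2 * s * inner ℝ x y + s ^ 2 * ‖y‖ ^ 2 := by
  have h := sq_nonneg ‖x + s • y‖
  rw [norm_add_sq_real, inner_smul_right, norm_smul, mul_pow, Real.norm_eq_abs, sq_abs] at h
  linarith

lemma nsq_div_le_neg_blockForm {t : ℝ} (ht : 0 < t) (ht1 : t ≤ 1) (y : E n × E n) :
    nsq y ≤ 6 * t * -blockForm (-3 / t ^ 3) (3 / (2 * t ^ 2)) (-1 / t) y := by
  have h := inner_bounds (t • y.2) y.1 (-(9 / 5))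
  rw [norm_smul, inner_smul_left, Real.norm_eq_abs, mul_pow, sq_abs] at h
  have e : 6 * t * -blockForm (-3 / t ^ 3) (3 / (2 * t ^ 2)) (-1 / t) y =
      18 * ‖y.1‖ ^ 2 / t ^ 2 - 18 * inner ℝ y.2 y.1 / t + 6 * ‖y.2‖ ^ 2 := by
    unfold blockForm; rw [real_inner_comm]; field_simp; ring
  rw [e, nsq]
  simp only [conj_trivial] at h
  have e2 : 18 * ‖y.1‖ ^ 2 / t ^ 2 - 18 * inner ℝ y.2 y.1 / t + 6 * ‖y.2‖ ^ 2 -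
      ‖y.2‖ ^ 2 - ‖y.1‖ ^ 2 =
      (5 * (t ^ 2 * ‖y.2‖ ^ 2 + 2 * -(9 / 5) * (t * inner ℝ y.2 y.1) + (-(9/5)) ^ 2 * ‖y.1‖ ^ 2)
        + (9 / 5 - t ^ 2) * ‖y.1‖ ^ 2) / t ^ 2 := by
    field_simp; ring
  have : 0 ≤ 18 * ‖y.1‖ ^ 2 / t ^ 2 - 18 * inner ℝ y.2 y.1 / t + 6 * ‖y.2‖ ^ 2 -
        ‖y.2‖ ^ 2 - ‖y.1‖ ^ 2 := by
    rw [e2]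
    have : 0 ≤ 9 / 5 - t ^ 2 := by nlinarith
    positivity
  linarith

lemma neg_mul_log_le {t : ℝ} (ht : 0 < t) : -(t * Real.log t) ≤ 2 * √t := by
  have hs := Real.sqrt_pos.2 ht
  have h := Real.one_sub_inv_le_log_of_pos hs
  rw [Real.log_sqrt ht.le] at h
  have h2 := mul_le_mul_of_nonneg_left h ht.le
  have h3 : t * (√t)⁻¹ = √t := by
    field_simp; exact (Real.sq_sqrt ht.le).symm
  nlinarith

lemma nsq_lt_of_lt_kolmogorovLog {z₁ z : E n × E n} {t₀ t e : ℝ} (ht : 0 < t) (ht1 : t ≤ 1)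
    (he : 0 ≤ e) (h : -e < kolmogorovLog z₁ t₀ t z) :
    nsq (z - transported z₁ t₀ t) < √t * (6 * e + 24 * n) := by
  have h1 := nsq_div_le_neg_blockForm ht ht1 (z - transported z₁ t₀ t)
  unfold kolmogorovLog at h
  have h2 := mul_le_mul_of_nonneg_left (neg_mul_log_le ht) (by positivity : (0:ℝ) ≤ 12 * n)
  have h3 : t ≤ √t := Real.le_sqrt_of_sq_le (by nlinarith)
  have h4 := mul_le_mul_of_nonneg_left h3 (by positivity : (0:ℝ) ≤ 6 * e)
  nlinarith [mul_lt_mul_of_pos_left h (by positivity : (0:ℝ) < 6 * t)]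

lemma nsq_add_le (x y : E n × E n) : nsq (x + y) ≤ 2 * nsq x + 2 * nsq y := by
  have := nsq_add_add_nsq_sub x y
  linarith [nsq_nonneg (x - y)]

lemma nsq_sub_le (x y : E n × E n) : nsq (x - y) ≤ 2 * nsq x + 2 * nsq y := by
  have := nsq_add_add_nsq_sub x y
  linarith [nsq_nonneg (x + y)]

lemma nsq_transported_le (z₁ : E n × E n) {t₀ t : ℝ} (h : t₀ ≤ t) (h1 : t - t₀ ≤ 1) :
    nsq (transported z₁ t₀ t) ≤ 3 * nsq z₁ := by
  have h2 := nsq_add_le (z₁.1, (0 : E n)) ((t - t₀) • z₁.2, (0 : E n))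
  simp only [nsq, transported, Prod.mk_add_mk, add_zero, norm_zero, norm_smul, Real.norm_eq_abs,
    mul_pow, sq_abs] at h2 ⊢
  have : (t - t₀) ^ 2 ≤ 1 := by nlinarith
  nlinarith [sq_nonneg ‖z₁.2‖, sq_nonneg ‖z₁.1‖]

lemma pd_fun_const (c : ℝ) (j : Fin n ⊕ Fin n) :
    pd (fun _ : E n × E n => c) j = fun _ => 0 := by
  ext p; simp [pd]

/-- The compactly supported subsolution `K e^{-B(t-t₀)} (exp (kolmogorovLog) - ε)`. -/
def kolmogorovBump (z₁ : E n × E n) (t₀ K B ε t : ℝ) (z : E n × E n) : ℝ :=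
  (K * Real.exp (-B * (t - t₀))) * (Real.exp (kolmogorovLog z₁ t₀ t z) + -ε)

lemma contDiff_kolmogorovBump (z₁ : E n × E n) (t₀ K B ε t : ℝ) :
    ContDiff ℝ 2 (kolmogorovBump z₁ t₀ K B ε t) :=
  contDiff_const.mul ((contDiff_kolmogorovLog z₁ t₀ t).exp.add contDiff_const)

lemma kineticOp_kolmogorovBump (z₁ : E n × E n) (t₀ K B ε t c : ℝ) (z : E n × E n) :
    kineticOp (fun _ => -c) (kolmogorovBump z₁ t₀ K B ε t) z =
      (K * Real.exp (-B * (t - t₀))) * (Real.exp (kolmogorovLog z₁ t₀ t z) *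
        logKineticOp (fun _ => -c) (kolmogorovLog z₁ t₀ t) z + c * ε) := by
  have hP := contDiff_kolmogorovLog z₁ t₀ t
  unfold kolmogorovBump
  rw [kineticOp_const_mul (hP.exp.add contDiff_const), kineticOp_fun_add hP.exp contDiff_const,
    kineticOp_exp hP]
  congr 2
  simp [kineticOp, lapV, pd_fun_const]

lemma hasDerivAt_kolmogorovBump (z₁ : E n × E n) (t₀ K B ε : ℝ) {t : ℝ} (ht : 0 < t) (c : ℝ)
    (z : E n × E n) :
    HasDerivAt (fun s => kolmogorovBump z₁ t₀ K B ε s z)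
      (-B * kolmogorovBump z₁ t₀ K B ε t z + (K * Real.exp (-B * (t - t₀))) *
        (Real.exp (kolmogorovLog z₁ t₀ t z) *
          (logKineticOp (fun _ => -c) (kolmogorovLog z₁ t₀ t) z + c))) t := by
  have h1 := ((((hasDerivAt_id t).sub_const t₀).const_mul (-B)).exp.const_mul K)
  have h2 := (hasDerivAt_kolmogorovLog z₁ t₀ ht c z).exp.add_const (-ε)
  refine (h1.mul h2).congr_deriv ?_
  simp only [kolmogorovBump, id]
  ring

lemma kolmogorovBump_subsolution {z₁ z : E n × E n} {t₀ K ε t c : ℝ}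
    (hpos : 0 < kolmogorovBump z₁ t₀ K (c + 1) ε t z) :
    -(c + 1) * kolmogorovBump z₁ t₀ K (c + 1) ε t z + (K * Real.exp (-(c + 1) * (t - t₀))) *
        (Real.exp (kolmogorovLog z₁ t₀ t z) *
          (logKineticOp (fun _ => -c) (kolmogorovLog z₁ t₀ t) z + c)) <
      kineticOp (fun _ => -c) (kolmogorovBump z₁ t₀ K (c + 1) ε t) z := by
  rw [kineticOp_kolmogorovBump]
  unfold kolmogorovBump at hpos ⊢
  generalize Real.exp (kolmogorovLog z₁ t₀ t z) = X at *
  generalize logKineticOp (fun _ => -c) (kolmogorovLog z₁ t₀ t) z = L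
  generalize K * Real.exp (-(c + 1) * (t - t₀)) = Y at *
  linarith

lemma continuousOn_kolmogorovBump (z₁ : E n × E n) {t₀ : ℝ} (ht₀ : 0 < t₀) (K B ε t₁ : ℝ) :
    ContinuousOn (fun s : ℝ × (E n × E n) => kolmogorovBump z₁ t₀ K B ε s.1 s.2)
      (Icc t₀ t₁ ×ˢ univ) := by
  have h0 : ∀ s ∈ Icc t₀ t₁ ×ˢ (univ : Set (E n × E n)), 0 < s.1 := fun s hs =>
    ht₀.trans_le hs.1.1
  have hne : ∀ s ∈ Icc t₀ t₁ ×ˢ (univ : Set (E n × E n)), s.1 ≠ 0 := fun s hs => (h0 s hs).ne'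
  unfold kolmogorovBump kolmogorovLog blockForm transported
  have h1 : ContinuousOn (fun s : ℝ × (E n × E n) => Real.log s.1) (Icc t₀ t₁ ×ˢ univ) :=
    continuousOn_fst.log hne
  have h3 : ContinuousOn (fun s : ℝ × (E n × E n) => -3 / s.1 ^ 3) (Icc t₀ t₁ ×ˢ univ) :=
    continuousOn_const.div (by fun_prop) fun s hs => pow_ne_zero _ (hne s hs)
  have h2 : ContinuousOn (fun s : ℝ × (E n × E n) => 3 / (2 * s.1 ^ 2)) (Icc t₀ t₁ ×ˢ univ) :=
    continuousOn_const.div (by fun_prop) fun s hs =>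
      mul_ne_zero two_ne_zero (pow_ne_zero _ (hne s hs))
  have h4 : ContinuousOn (fun s : ℝ × (E n × E n) => -1 / s.1) (Icc t₀ t₁ ×ˢ univ) :=
    continuousOn_const.div (by fun_prop) hne
  simp only [Prod.fst_sub, Prod.snd_sub]
  fun_prop

/-- Gaussian lower bound: a lower bound for a stationary positive solution on a ball of squared
radius `r` around `z₁` propagates, with quadratic loss, to every other point. -/
theorem exists_lower_bound_of_ball {h φ : E n × E n → ℝ} {Ch : ℝ}
    (hφ : ContDiff ℝ 2 φ) (hsol : ∀ p, logKineticOp h φ p = 0) (hCh : 0 ≤ Ch)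
    (hlow : ∀ p, -(Ch * (1 + nsq p)) ≤ h p) :
    ∃ C, 0 ≤ C ∧ ∀ z₁ z₂ : E n × E n, ∀ r k : ℝ, 0 < r → r ≤ 1 →
      (∀ z, nsq (z - z₁) ≤ r → k ≤ φ z) →
      k + 4 * n * Real.log r - C * (1 + nsq z₁ + nsq z₂) ≤ φ z₂ := by
  refine ⟨4 * n * (186 + 24 * n) + Ch * (379 + 48 * n) + 32, by positivity, ?_⟩
  intro z₁ z₂ r k hr hr1 hball
  have hN₁ := nsq_nonneg z₁
  have hN₂ := nsq_nonneg z₂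
  obtain ⟨e, he⟩ : ∃ e, e = 10 * nsq z₂ + 30 * nsq z₁ := ⟨_, rfl⟩
  obtain ⟨G, hG⟩ : ∃ G : ℝ, G = 6 * (e + 1) + 24 * n := ⟨_, rfl⟩
  have hn0 : (0:ℝ) ≤ n := Nat.cast_nonneg n
  have he0 : 0 ≤ e := by rw [he]; positivity
  have hG6 : 6 ≤ G := by rw [hG]; linarith
  obtain ⟨t₀, ht₀⟩ : ∃ t₀, t₀ = (r / G) ^ 2 := ⟨_, rfl⟩
  have hrG : 0 < r / G := by positivity
  have hrG1 : r / G ≤ 1 := by rw [div_le_one (by linarith)]; linarith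
  have ht₀0 : 0 < t₀ := by rw [ht₀]; positivity
  have ht₀1 : t₀ ≤ 1 := by rw [ht₀]; nlinarith
  have hs0 : √t₀ * G = r := by
    rw [ht₀, Real.sqrt_sq hrG.le]; field_simp
  obtain ⟨R, hR⟩ : ∃ R, R = 2 * G + 6 * nsq z₁ := ⟨_, rfl⟩
  have hR0 : 0 ≤ R := by rw [hR]; linarith
  obtain ⟨c, hc⟩ : ∃ c, c = Ch * (1 + R) := ⟨_, rfl⟩
  have hc0 : 0 ≤ c := by rw [hc]; positivity
  obtain ⟨κ, hκ⟩ : ∃ κ, κ = k + 2 * n * Real.log t₀ := ⟨_, rfl⟩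
  have hgt : ∀ t z, 0 < kolmogorovBump z₁ t₀ (Real.exp κ) (c + 1) (Real.exp (-(e + 1))) t z →
      -(e + 1) < kolmogorovLog z₁ t₀ t z := by
    intro t z hpos
    have := pos_of_mul_pos_right hpos (by positivity)
    exact Real.exp_lt_exp.1 (by linarith)
  have hY : ∀ t ∈ Icc t₀ 1, ∀ z,
      0 < kolmogorovBump z₁ t₀ (Real.exp κ) (c + 1) (Real.exp (-(e + 1))) t z →
      nsq (z - transported z₁ t₀ t) < √t * G := fun t ht z hpos =>
    hG ▸ nsq_lt_of_lt_kolmogorovLog (ht₀0.trans_le ht.1) ht.2 (by linarith) (hgt t z hpos)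
  have key := le_exp_of_subsolution (t₀ := t₀) (t₁ := 1) (R := R) hφ hsol hc0 ?_
    (fun t _ => contDiff_kolmogorovBump z₁ t₀ (Real.exp κ) (c + 1) (Real.exp (-(e + 1))) t)
    (fun t ht z => hasDerivAt_kolmogorovBump z₁ t₀ (Real.exp κ) (c + 1) (Real.exp (-(e + 1)))
      (ht₀0.trans_le ht.1) c z)
    (continuousOn_kolmogorovBump z₁ ht₀0 _ _ _ _) ?_ ?_ ?_ 1 ⟨ht₀1, le_rfl⟩ z₂
  · have hY2 : nsq (z₂ - transported z₁ t₀ 1) ≤ 2 * nsq z₂ + 6 * nsq z₁ := by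
      have := nsq_sub_le z₂ (transported z₁ t₀ 1)
      have := nsq_transported_le z₁ ht₀1 (by linarith)
      linarith
    have hP : -e ≤ kolmogorovLog z₁ t₀ 1 z₂ := by
      have h1 := inner_bounds (z₂ - transported z₁ t₀ 1).1 (z₂ - transported z₁ t₀ 1).2 1
      simp only [kolmogorovLog, Real.log_one, blockForm]
      rw [he]
      unfold nsq at hY2 ⊢
      nlinarith [sq_nonneg ‖(z₂ - transported z₁ t₀ 1).1‖,
        sq_nonneg ‖(z₂ - transported z₁ t₀ 1).2‖]
    have hlow2 : Real.exp (-(e + 1)) ≤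
        Real.exp (kolmogorovLog z₁ t₀ 1 z₂) + -Real.exp (-(e + 1)) := by
      have h1 : Real.exp (-e) = Real.exp (-(e + 1)) * Real.exp 1 := by
        rw [← Real.exp_add]; congr 1; ring
      have h2 := Real.add_one_le_exp (1:ℝ)
      have h3 := Real.exp_le_exp.2 hP
      nlinarith [Real.exp_pos (-(e + 1))]
    have h4 : Real.exp (κ + -(c + 1) * (1 - t₀) + -(e + 1)) ≤ Real.exp (φ z₂) := by
      rw [Real.exp_add, Real.exp_add]
      exact (mul_le_mul_of_nonneg_left hlow2 (by positivity)).trans key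
    have h5 := Real.exp_le_exp.1 h4
    have h6 : Real.log t₀ = 2 * (Real.log r - Real.log G) := by
      rw [ht₀, Real.log_pow, Real.log_div hr.ne' (by linarith)]; norm_num
    have h7 := (Real.log_le_sub_one_of_pos (by linarith : 0 < G))
    have h8 : 4 * n * Real.log G ≤ 4 * n * (186 + 24 * n) * (1 + nsq z₁ + nsq z₂) := by
      rw [mul_assoc (4 * (n:ℝ))]
      refine mul_le_mul_of_nonneg_left ?_ (by positivity)
      have : 0 ≤ n * nsq z₁ := by positivity
      have : 0 ≤ n * nsq z₂ := by positivity
      nlinarith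
    have h9 : c ≤ Ch * (379 + 48 * n) * (1 + nsq z₁ + nsq z₂) := by
      rw [hc, mul_assoc]
      refine mul_le_mul_of_nonneg_left ?_ hCh
      have : 0 ≤ n * nsq z₁ := by positivity
      have : 0 ≤ n * nsq z₂ := by positivity
      nlinarith
    have h10 : (c + 1) * t₀ ≥ 0 := by positivity
    nlinarith
  · intro p hp
    have := mul_le_mul_of_nonneg_left hp hCh
    linarith [hlow p]
  · intro t ht z hpos
    exact kolmogorovBump_subsolution hpos
  · intro t ht z hpos
    have h1 := hY t ht z hpos
    have h2 := nsq_add_le (z - transported z₁ t₀ t) (transported z₁ t₀ t)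
    rw [sub_add_cancel] at h2
    have h3 := nsq_transported_le z₁ ht.1 (by linarith [ht.2])
    have h4 := mul_le_mul_of_nonneg_right (Real.sqrt_le_one.2 ht.2) (by linarith : 0 ≤ G)
    linarith
  · intro z
    by_cases hpos : 0 < kolmogorovBump z₁ t₀ (Real.exp κ) (c + 1) (Real.exp (-(e + 1))) t₀ z
    · have h1 := hY t₀ ⟨le_rfl, ht₀1⟩ z hpos
      have e1 : transported z₁ t₀ t₀ = z₁ := by simp [transported]
      rw [e1, hs0] at h1
      refine le_trans ?_ (Real.exp_le_exp.2 (hball z h1.le))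
      have h2 := nsq_div_le_neg_blockForm ht₀0 ht₀1 (z - transported z₁ t₀ t₀)
      have h3 : kolmogorovLog z₁ t₀ t₀ z ≤ -(2 * n * Real.log t₀) := by
        have h4 := nonneg_of_mul_nonneg_right ((nsq_nonneg _).trans h2) (by positivity)
        simp only [kolmogorovLog]
        linarith
      have h4 : Real.exp k = Real.exp κ * Real.exp (-(2 * n * Real.log t₀)) := by
        rw [← Real.exp_add]; congr 1; linarith
      rw [h4]
      simp only [kolmogorovBump, sub_self, mul_zero, Real.exp_zero, mul_one]
      refine mul_le_mul_of_nonneg_left ?_ (Real.exp_pos _).le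
      linarith [Real.exp_le_exp.2 h3, Real.exp_pos (-(e + 1))]
    · linarith [Real.exp_pos (φ z)]

lemma contDiff_hfun {U : E n × E n → ℝ} (hU : ContDiff ℝ (⊤ : ℕ∞) U) : ContDiff ℝ 2 (hfun U) := by
  have h1 : ∀ j, ContDiff ℝ 3 (pd U j) := fun j =>
      contDiff_pd (contDiff_infty.1 hU 4) (by norm_num) j
  have h2 : ∀ j, ContDiff ℝ 2 (pd U j) := fun j => (h1 j).of_le (by norm_num)
  have h3 : ∀ j, ContDiff ℝ 2 (pd (pd U j) j) := fun j => contDiff_pd (h1 j) (by norm_num) j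
  unfold hfun lapV
  have h4 : ∀ i, ContDiff ℝ 2 fun p : E n × E n => p.2 i := fun i => contDiff_coord (Sum.inr i)
  have h5 : ContDiff ℝ 2 fun p : E n × E n => ∑ i : Fin n, p.2 i * pd U (Sum.inl i) p :=
    ContDiff.sum fun i _ => (h4 i).mul (h2 _)
  have h6 : ContDiff ℝ 2 fun p : E n × E n => ∑ i : Fin n, pd (pd U (Sum.inr i)) (Sum.inr i) p :=
    ContDiff.sum fun i _ => h3 _
  have h7 : ContDiff ℝ 2 fun p : E n × E n => ∑ i : Fin n, pd U (Sum.inr i) p ^ 2 :=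
    ContDiff.sum fun i _ => (h2 _).pow 2
  exact ((contDiff_const.mul h5).add (contDiff_const.mul h6)).sub (contDiff_const.mul h7)

lemma logKineticOp_neg_half {U : E n × E n → ℝ} (hU : ContDiff ℝ 2 U) (p : E n × E n) :
    logKineticOp (hfun U) (fun q => -(1 / 2) * U q) p = 0 := by
  simp only [logKineticOp, hfun, lapV_const_mul hU, pd_const_mul (differentiable_of_two hU),
    mul_pow, ← Finset.mul_sum, mul_left_comm _ (-(1 / 2) : ℝ)]
  ring

lemma le_hessForm_of_posSemidef {φ : E n × E n → ℝ} {a b : ℝ} {p : E n × E n}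
    (h : (Hess φ p - blockDiag n (-a) (-b)).PosSemidef) (y : E n × E n) :
    -(a * ‖y.1‖ ^ 2) - b * ‖y.2‖ ^ 2 ≤ hessForm φ p y := by
  have h1 := form_nonneg h y
  have h2 := form_fromBlocks (-a) 0 (-b) y
  rw [zero_smul] at h2
  rw [form_sub, _root_.blockDiag, h2] at h1
  unfold blockForm at h1
  unfold hessForm
  linarith

lemma nsq_smul (s : ℝ) (y : E n × E n) : nsq (s • y) = s ^ 2 * nsq y := by
  simp [nsq, norm_smul, mul_pow]; ring

lemma nsq_neg (y : E n × E n) : nsq (-y) = nsq y := by simp [nsq]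

lemma norm_le_one_add_nsq (y : E n × E n) : ‖y‖ ≤ 1 + nsq y := by
  rw [Prod.norm_def, nsq]
  refine max_le ?_ ?_ <;> nlinarith [sq_nonneg (‖y.1‖ - 1), sq_nonneg (‖y.2‖ - 1)]

lemma semiconcave_lower {φ : E n × E n → ℝ} (hφ : ContDiff ℝ 2 φ) {K : ℝ}
    (h : ∀ p y, -(K * nsq y) ≤ hessForm φ p y) (p y : E n × E n) :
    φ p + fderiv ℝ φ p y - K / 2 * nsq y ≤ φ (p + y) := by
  linarith [le_of_le_hessForm hφ (p := p) (y := y) fun s _ => h (p + s • y) y]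

lemma exists_quadratic_lower {φ : E n × E n → ℝ} (hφ : ContDiff ℝ 2 φ) {K : ℝ} (hK : 0 ≤ K)
    (h : ∀ p y, -(K * nsq y) ≤ hessForm φ p y) :
    ∃ C, 0 ≤ C ∧ ∀ p, -(C * (1 + nsq p)) ≤ φ p := by
  refine ⟨|φ 0| + ‖fderiv ℝ φ 0‖ + K, by positivity, fun p => ?_⟩
  have h1 := semiconcave_lower hφ h 0 p
  rw [zero_add] at h1
  have h2 := (abs_le.1 ((fderiv ℝ φ 0).le_opNorm p)).1
  have h3 := mul_le_mul_of_nonneg_left (norm_le_one_add_nsq p) (norm_nonneg (fderiv ℝ φ 0))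
  have h4 := nsq_nonneg p
  nlinarith [neg_abs_le (φ 0), abs_nonneg (φ 0), mul_nonneg (abs_nonneg (φ 0)) h4,
    mul_nonneg hK h4]

/-- A linear functional is nonpositive on some ball of radius `r` whose centre has norm at
most `r`. -/
lemma exists_ball_linear_nonpos (L : E n × E n →L[ℝ] ℝ) {r : ℝ} (hr : 0 ≤ r) :
    ∃ η : E n × E n, nsq η ≤ r ∧ ∀ y, nsq (y - η) ≤ r → L y ≤ 0 := by
  obtain ⟨η, hη, hmin⟩ := (isCompact_nsq_le (n := n) r).exists_isMinOn
    ⟨0, by simpa [nsq] using hr⟩ L.continuous.continuousOn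
  refine ⟨η, hη, fun y hy => ?_⟩
  have : L η ≤ L (-(y - η)) := hmin (show nsq (-(y - η)) ≤ r by rwa [nsq_neg])
  simp only [map_neg, map_sub] at this
  linarith

lemma exists_upper_of_stationary {φ : E n × E n → ℝ} {C : ℝ} (hφ : ContDiff ℝ 2 φ)
    (hC : 0 ≤ C) (hbd : ∀ z₁ z₂ : E n × E n, ∀ r k : ℝ, 0 < r → r ≤ 1 →
      (∀ z, nsq (z - z₁) ≤ r → k ≤ φ z) →
      k + 4 * n * Real.log r - C * (1 + nsq z₁ + nsq z₂) ≤ φ z₂) :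
    ∃ C', 0 ≤ C' ∧ ∀ z, -(C' * (1 + nsq z)) ≤ φ z := by
  obtain ⟨w, -, hmin⟩ := (isCompact_nsq_le (n := n) 1).exists_isMinOn
    ⟨0, by simp [nsq]⟩ hφ.continuous.continuousOn
  refine ⟨|φ w| + C, by positivity, fun z => ?_⟩
  have := hbd 0 z 1 (φ w) one_pos le_rfl fun z hz => hmin (by simpa using hz)
  simp only [Real.log_one, show nsq (0 : E n × E n) = 0 by simp [nsq]] at this
  nlinarith [neg_abs_le (φ w), mul_nonneg (abs_nonneg (φ w)) (nsq_nonneg z)]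

lemma exists_lower_of_stationary {φ : E n × E n → ℝ} {C a₀ a₁ : ℝ} (hφ : ContDiff ℝ 2 φ)
    (ha₀ : 0 < a₀) (ha₁ : 0 < a₁) (hC : 0 ≤ C)
    (hbd : ∀ z₁ z₂ : E n × E n, ∀ r k : ℝ, 0 < r → r ≤ 1 →
      (∀ z, nsq (z - z₁) ≤ r → k ≤ φ z) →
      k + 4 * n * Real.log r - C * (1 + nsq z₁ + nsq z₂) ≤ φ z₂)
    (hess : ∀ p y, -(a₀ * Real.exp (a₁ * nsq p) * nsq y) ≤ hessForm φ p y) :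
    ∃ C', 0 ≤ C' ∧ ∀ z, φ z ≤ C' * (1 + nsq z) := by
  refine ⟨|φ 0| + 2 + 4 * n * (Real.log (1 + a₀) + 8 * a₁) + 3 * C, ?_, fun z₁ => ?_⟩
  · have := Real.log_nonneg (by linarith : 1 ≤ 1 + a₀)
    positivity
  obtain ⟨Λ, hΛ⟩ : ∃ Λ, Λ = a₀ * Real.exp (a₁ * (2 * nsq z₁ + 8)) := ⟨_, rfl⟩
  have hN := nsq_nonneg z₁
  have hΛ0 : 0 < Λ := by rw [hΛ]; positivity
  obtain ⟨r, hr⟩ : ∃ r, r = 1 / (1 + Λ) := ⟨_, rfl⟩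
  have hr0 : 0 < r := by rw [hr]; positivity
  have hr1 : r ≤ 1 := by rw [hr, div_le_one (by linarith)]; linarith
  have hrΛ : Λ * r ≤ 1 := by rw [hr, mul_one_div, div_le_one (by linarith)]; linarith
  obtain ⟨η, hη, hL⟩ := exists_ball_linear_nonpos (-fderiv ℝ φ z₁) hr0.le
  have hball : ∀ z, nsq (z - (z₁ + η)) ≤ r → φ z₁ - 2 ≤ φ z := by
    intro z hz
    obtain ⟨y, rfl⟩ : ∃ y, z = z₁ + y := ⟨z - z₁, by abel⟩
    rw [add_sub_add_left_eq_sub] at hz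
    have h1 := hL y hz
    have h2 : nsq y ≤ 4 * r := by
      have := nsq_add_le (y - η) η
      rw [sub_add_cancel] at this
      linarith
    have h3 := le_of_le_hessForm hφ (p := z₁) (y := y) (Λ := -(Λ * nsq y)) fun s hs => by
      refine le_trans (neg_le_neg (mul_le_mul_of_nonneg_right ?_ (nsq_nonneg y))) (hess _ y)
      rw [hΛ]
      have h4 := nsq_add_le z₁ (s • y)
      rw [nsq_smul] at h4
      have h5 : s ^ 2 * nsq y ≤ 1 * 4 :=
        mul_le_mul (by nlinarith [hs.1, hs.2]) (by linarith) (nsq_nonneg y) (by norm_num)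
      gcongr
      linarith
    simp only [_root_.neg_apply] at h1
    nlinarith [mul_le_mul_of_nonneg_left h2 hΛ0.le]
  have h1 := hbd (z₁ + η) 0 r _ hr0 hr1 hball
  have h2 : nsq (z₁ + η) ≤ 2 * nsq z₁ + 2 := by linarith [nsq_add_le z₁ η]
  have h3 : Real.log (1 + Λ) ≤ Real.log (1 + a₀) + a₁ * (2 * nsq z₁ + 8) := by
    rw [← Real.log_exp (a₁ * (2 * nsq z₁ + 8)), ← Real.log_mul (by linarith) (Real.exp_pos _).ne']
    refine Real.log_le_log (by linarith) ?_
    have : 1 ≤ Real.exp (a₁ * (2 * nsq z₁ + 8)) := Real.one_le_exp (by positivity)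
    rw [hΛ]; linarith
  have h4 : Real.log r = -Real.log (1 + Λ) := by rw [hr, one_div, Real.log_inv]
  rw [h4, show nsq (0 : E n × E n) = 0 by simp [nsq]] at h1
  have h5 := mul_le_mul_of_nonneg_left h3 (by positivity : (0:ℝ) ≤ 4 * n)
  have h6 := mul_le_mul_of_nonneg_left h2 hC
  have h7 := Real.log_nonneg (by linarith : 1 ≤ 1 + a₀)
  have h8 : 0 ≤ |φ 0| * nsq z₁ := by positivity
  have h9 : 0 ≤ 4 * n * Real.log (1 + a₀) * nsq z₁ := by positivity
  have h10 : 0 ≤ n * a₁ * nsq z₁ := by positivity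
  have h11 : 0 ≤ C * nsq z₁ := by positivity
  nlinarith [le_abs_self (φ 0)]

lemma hfun_le_of_isLocalMax {U : E n × E n → ℝ} (hU : ContDiff ℝ 2 U) {A : ℝ} (hA : 0 ≤ A)
    {z₁ z : E n × E n}
    (h : IsLocalMin (fun p => (0 + blockForm A 0 A (p - z₁)) + (-1) * U p) z) :
    hfun U z ≤ A * (nsq z + nsq (z - z₁)) + A * n := by
  have hb := contDiff_blockForm A 0 A 0 z₁ (N := 2)
  have h1 := lapV_nonneg_of_isLocalMin (hb.add (contDiff_const.mul hU)) h
  rw [lapV_fun_add hb (contDiff_const.mul hU), lapV_blockForm, lapV_const_mul hU] at h1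
  have h2 : ∀ i, pd U (Sum.inl i) z = 2 * A * (z - z₁).1 i := by
    intro i
    have := pd_eq_zero_of_isLocalMin h (Sum.inl i)
    rw [pd_fun_add (differentiable_of_two hb) (differentiable_of_two (contDiff_const.mul hU)),
      pd_blockForm_inl, pd_const_mul (differentiable_of_two hU)] at this
    linarith
  have h3 : 0 ≤ ∑ i : Fin n, pd U (Sum.inr i) z ^ 2 := Finset.sum_nonneg fun i _ => sq_nonneg _
  have h4 := (abs_le.1 (abs_two_mul_sum_le z.2 (z - z₁).1)).1
  have h5 : ∑ i : Fin n, z.2 i * pd U (Sum.inl i) z =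
        A * (2 * ∑ i : Fin n, z.2 i * (z - z₁).1 i) := by
    simp only [h2, Finset.mul_sum]
    exact Finset.sum_congr rfl fun i _ => by ring
  unfold hfun
  rw [h5]
  have h6 : ‖z.2‖ ^ 2 + ‖(z - z₁).1‖ ^ 2 ≤ nsq z + nsq (z - z₁) := by
    unfold nsq; nlinarith [sq_nonneg ‖z.1‖, sq_nonneg ‖(z - z₁).2‖]
  have h7 := nsq_nonneg z
  have h8 := nsq_nonneg (z - z₁)
  nlinarith [mul_le_mul_of_nonneg_left h6 hA, mul_le_mul_of_nonneg_left h4 hA,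
    mul_nonneg hA (add_nonneg h7 h8)]

lemma exists_hfun_upper {U : E n × E n → ℝ} (hU : ContDiff ℝ 2 U) (hh : ContDiff ℝ 2 (hfun U))
    {C K : ℝ} (hC : 0 ≤ C) (hK : 0 ≤ K) (hUC : ∀ z, |U z| ≤ C * (1 + nsq z))
    (hK' : ∀ p y, -(K * nsq y) ≤ hessForm (hfun U) p y) :
    ∃ C', 0 ≤ C' ∧ ∀ z, hfun U z ≤ C' * (1 + nsq z) := by
  refine ⟨(22 * C + 1) * (11 + n) + 2 * K, by positivity, fun z₀ => ?_⟩
  have hN := nsq_nonneg z₀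
  obtain ⟨r, hr⟩ : ∃ r, r = 1 + nsq z₀ := ⟨_, rfl⟩
  obtain ⟨A, hA⟩ : ∃ A, A = 22 * C + 1 := ⟨_, rfl⟩
  have hA0 : 0 < A := by rw [hA]; positivity
  have hr0 : 0 < r := by rw [hr]; positivity
  obtain ⟨η, hη, hL⟩ := exists_ball_linear_nonpos (-fderiv ℝ (hfun U) z₀) hr0.le
  obtain ⟨z₁, hz₁⟩ : ∃ z₁, z₁ = z₀ + η := ⟨_, rfl⟩
  have hz₁r : nsq z₁ ≤ 4 * r := by rw [hz₁]; linarith [nsq_add_le z₀ η]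
  have hin : ∀ z, nsq (z - z₁) ≤ r → nsq z ≤ 10 * r := by
    intro z hz
    have := nsq_add_le (z - z₁) z₁
    rw [sub_add_cancel] at this
    linarith
  have hUle : ∀ z, nsq (z - z₁) ≤ r → |U z| ≤ C * (11 * r) := fun z hz =>
    (hUC z).trans (mul_le_mul_of_nonneg_left (by linarith [hin z hz]) hC)
  have hbn : ∀ z, blockForm A 0 A (z - z₁) = A * nsq (z - z₁) := fun z => by
    unfold blockForm nsq; ring
  have hcpt : IsCompact {z : E n × E n | nsq (z - z₁) ≤ r} := by
    have := (isCompact_nsq_le (n := n) r).image (continuous_add_const z₁)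
    convert this using 1
    ext z
    simp only [mem_ofPred_eq, mem_image]
    exact ⟨fun h => ⟨z - z₁, h, sub_add_cancel _ _⟩, by rintro ⟨w, hw, rfl⟩; simpa using hw⟩
  have hcont : Continuous fun p => (0 + blockForm A 0 A (p - z₁)) + (-1) * U p :=
    (contDiff_blockForm A 0 A 0 z₁ (N := 2)).continuous.add (continuous_const.mul hU.continuous)
  have hz₁mem : nsq (z₁ - z₁) ≤ r := by simpa [nsq] using hr0.le
  obtain ⟨z, hz, hmin⟩ := hcpt.exists_isMinOn ⟨z₁, hz₁mem⟩ hcont.continuousOn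
  have hlt : nsq (z - z₁) < r := by
    have h1 : (0 + blockForm A 0 A (z - z₁)) + (-1) * U z ≤
      (0 + blockForm A 0 A (z₁ - z₁)) + (-1) * U z₁ := hmin hz₁mem
    rw [hbn, hbn, show nsq (z₁ - z₁) = 0 by simp [nsq]] at h1
    have h2 := (abs_le.1 (hUle z hz)).2
    have h3 := (abs_le.1 (hUle z₁ hz₁mem)).1
    by_contra hge
    have h4 := mul_le_mul_of_nonneg_left (not_lt.1 hge) hA0.le
    have : A * r = 22 * C * r + r := by rw [hA]; ring
    linarith
  have hloc : IsLocalMin (fun p => (0 + blockForm A 0 A (p - z₁)) + (-1) * U p) z := by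
    have ho : IsOpen {z : E n × E n | nsq (z - z₁) < r} :=
      isOpen_lt ((contDiff_nsq (k := 2)).continuous.comp (continuous_sub_right z₁)) continuous_const
    filter_upwards [ho.mem_nhds hlt] with p hp
    exact hmin (le_of_lt hp)
  have h1 := hfun_le_of_isLocalMax hU hA0.le hloc
  have h2 := hin z hz
  obtain ⟨y, hy⟩ : ∃ y, z = z₀ + y := ⟨z - z₀, by abel⟩
  have hyη : nsq (y - η) ≤ r := by
    have := hlt.le
    rwa [hy, hz₁, add_sub_add_left_eq_sub] at this
  have h3 := hL y hyη
  rw [_root_.neg_apply] at h3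
  have h4 := semiconcave_lower hh hK' z₀ y
  rw [← hy] at h4
  have h5 : nsq y ≤ 4 * r := by
    have := nsq_add_le (y - η) η
    rw [sub_add_cancel] at this
    linarith
  have h6 := mul_le_mul_of_nonneg_left h5 hK
  have h7 : A * (nsq z + nsq (z - z₁)) ≤ A * (11 * r) :=
      mul_le_mul_of_nonneg_left (by linarith) hA0.le
  have h8 : A * n ≤ A * n * r := le_mul_of_one_le_right (by positivity) (by linarith)
  rw [← hr, ← hA]
  linarith

lemma log_le_of_gradient_bound {f : E n × E n → ℝ} (hf : Differentiable ℝ f) (hpos : ∀ z, 0 < f z)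
    {a C M : ℝ} (ha : 0 < a) (hC : 0 ≤ C) (hM : f 0 ≤ M)
    (hgrad : ∀ p, Real.sqrt (gradNormSq f p) ≤
      a * Real.exp (C * (1 + nsq p)) * (‖p.1‖ + ‖p.2‖)) (z : E n × E n) :
    Real.log (f z) ≤ Real.log (M + a) + (C + 2) * (1 + nsq z) := by
  have hN := nsq_nonneg z
  have hM0 := (hpos 0).trans_le hM
  obtain ⟨s, hs, hd⟩ := exists_hasDerivAt_eq_slope (fun s : ℝ => f (0 + s • z)) _ one_pos
    (fun s _ => (hasDerivAt_line hf 0 z s).continuousAt.continuousWithinAt)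
    (fun s _ => hasDerivAt_line hf 0 z s)
  simp only [zero_smul, one_smul, zero_add, sub_zero, div_one] at hd
  have h1 : fderiv ℝ f (s • z) z ≤ √(gradNormSq f (s • z)) * √(nsq z) := by
    rw [fderiv_eq_sum_pd, nsq_eq_sum, gradNormSq, mul_comm]
    exact Real.sum_mul_le_sqrt_mul_sqrt _ _ _
  have hsN : nsq (s • z) ≤ nsq z := by
    rw [nsq_smul]
    exact mul_le_of_le_one_left hN (pow_le_one₀ hs.1.le hs.2.le)
  have h2 : √(nsq z) ≤ 1 + nsq z := by
    rw [Real.sqrt_le_left (by linarith)]; nlinarith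
  have h3 : ‖(s • z).1‖ + ‖(s • z).2‖ ≤ 1 + nsq z := by
    refine le_trans ?_ (add_le_add_right hsN 1)
    unfold nsq
    nlinarith [sq_nonneg (‖(s • z).1‖ - 1), sq_nonneg (‖(s • z).2‖ - 1)]
  have h4 : √(gradNormSq f (s • z)) ≤ a * Real.exp (C * (1 + nsq z)) * (1 + nsq z) := by
    refine (hgrad _).trans ?_
    gcongr
  have h5 : 1 + nsq z ≤ Real.exp (1 + nsq z) := by linarith [Real.add_one_le_exp (1 + nsq z)]
  have h6 : f z ≤ (M + a) * Real.exp ((C + 2) * (1 + nsq z)) := by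
    have e : Real.exp ((C + 2) * (1 + nsq z)) =
        Real.exp (C * (1 + nsq z)) * Real.exp (1 + nsq z) * Real.exp (1 + nsq z) := by
      rw [← Real.exp_add, ← Real.exp_add]; congr 1; ring
    have h7 : √(gradNormSq f (s • z)) * √(nsq z) ≤ a * Real.exp ((C + 2) * (1 + nsq z)) := by
      calc _ ≤ a * Real.exp (C * (1 + nsq z)) * (1 + nsq z) * (1 + nsq z) := by gcongr
        _ ≤ a * Real.exp (C * (1 + nsq z)) * Real.exp (1 + nsq z) * Real.exp (1 + nsq z) := by
          gcongr
        _ = _ := by rw [e]; ring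
    have h8 : 1 ≤ Real.exp ((C + 2) * (1 + nsq z)) := Real.one_le_exp (by positivity)
    have h9 := mul_le_mul_of_nonneg_left h8 hM0.le
    linarith
  have h10 := Real.log_le_log (hpos z) h6
  rwa [Real.log_mul (by linarith) (Real.exp_pos _).ne', Real.log_exp] at h10

lemma hessForm_const_mul {φ : E n × E n → ℝ} (hφ : ContDiff ℝ 2 φ) (c : ℝ) (p y : E n × E n) :
    hessForm (fun q => c * φ q) p y = c * hessForm φ p y := by
  simp only [hessForm, Hess, Matrix.of_apply, pd_const_mul (differentiable_of_two hφ),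
    pd_const_mul (differentiable_pd hφ _), Finset.mul_sum]
  exact Finset.sum_congr rfl fun i _ => Finset.sum_congr rfl fun j _ => by ring

lemma neg_le_hessForm_of_posSemidef {φ : E n × E n → ℝ} {a b : ℝ}
    (h : ∀ p, (Hess φ p - _root_.blockDiag n (-a) (-b)).PosSemidef) (p y : E n × E n) :
    -((|a| + |b|) * nsq y) ≤ hessForm φ p y := by
  have h1 := le_hessForm_of_posSemidef (h p) y
  unfold nsq
  nlinarith [sq_nonneg ‖y.1‖, sq_nonneg ‖y.2‖, le_abs_self a, le_abs_self b, abs_nonneg a,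
    abs_nonneg b]

/-- The potential has at most quadratic growth. -/
theorem exists_abs_potential_le {U : E n × E n → ℝ} (hU : ContDiff ℝ (⊤ : ℕ∞) U) {a₀ a₁ K : ℝ}
    (ha₀ : 0 < a₀) (ha₁ : 0 < a₁) (hK : 0 ≤ K)
    (hgrow3 : ∀ p : E n × E n,
      ((a₀ * Real.exp (a₁ * (‖p.1‖ ^ 2 + ‖p.2‖ ^ 2))) •
        (1 : Matrix (Fin n ⊕ Fin n) (Fin n ⊕ Fin n) ℝ) - Hess U p).PosSemidef)
    (hh : ∀ p y, -(K * nsq y) ≤ hessForm (hfun U) p y) :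
    ∃ C, 0 ≤ C ∧ ∀ z, |U z| ≤ C * (1 + nsq z) := by
  have hU2 := contDiff_two_of_top hU
  have hφ : ContDiff ℝ 2 fun q => -(1 / 2) * U q := contDiff_const.mul hU2
  obtain ⟨Ch, hCh, hlow⟩ := exists_quadratic_lower (contDiff_hfun hU) hK hh
  obtain ⟨C, hC, hbd⟩ := exists_lower_bound_of_ball hφ (logKineticOp_neg_half hU2) hCh hlow
  obtain ⟨C₁, hC₁, h₁⟩ := exists_upper_of_stationary hφ hC hbd
  obtain ⟨C₂, hC₂, h₂⟩ := exists_lower_of_stationary hφ ha₀ ha₁ hC hbd fun p y => by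
    have h3 := form_nonneg (hgrow3 p) y
    rw [form_sub, form_smul, form_one] at h3
    rw [hessForm_const_mul hU2]
    change 0 ≤ a₀ * Real.exp (a₁ * nsq p) * nsq y - hessForm U p y at h3
    have : 0 ≤ a₀ * Real.exp (a₁ * nsq p) * nsq y := mul_nonneg (by positivity) (nsq_nonneg y)
    linarith
  refine ⟨2 * (C₁ + C₂), by positivity, fun z => abs_le.2 ⟨?_, ?_⟩⟩
  · nlinarith [h₂ z, mul_nonneg hC₁ (by linarith [nsq_nonneg z] : 0 ≤ 1 + nsq z)]
  · nlinarith [h₁ z, mul_nonneg hC₂ (by linarith [nsq_nonneg z] : 0 ≤ 1 + nsq z)]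

lemma logSolution_stationary {U : E n × E n → ℝ} (hU : ContDiff ℝ 2 U) (T : ℝ) {C : ℝ}
    (hUC : ∀ z, |U z| ≤ C * (1 + nsq z)) :
    LogSolution (hfun U) T fun _ q => -(1 / 2) * U q where
  contDiff _ _ := contDiff_const.mul hU
  hasDerivAt t _ z := by
    rw [logKineticOp_neg_half hU]
    exact hasDerivAt_const _ _
  continuousOn := by
    have := hU.continuous
    fun_prop
  growth _ _ _ _ := ⟨C, fun _ _ z => by
    nlinarith [(abs_le.1 (hUC z)).1, abs_nonneg (U z), hUC z]⟩

lemma logKineticOp_log_sub {U f : E n × E n → ℝ} (hU : ContDiff ℝ 2 U) (hf : ContDiff ℝ 2 f)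
    (hpos : ∀ p, 0 < f p) (p : E n × E n) :
    logKineticOp (hfun U) (fun q => Real.log (f q) + -(1 / 2) * U q) p =
      (f p)⁻¹ * (lapV f p - (∑ i : Fin n, pd U (Sum.inr i) p * pd f (Sum.inr i) p)
          - ∑ i : Fin n, p.2 i * pd f (Sum.inl i) p) := by
  obtain ⟨g, hg⟩ : ∃ g : E n × E n → ℝ, g = fun q => Real.log (f q) := ⟨_, rfl⟩
  have hg2 : ContDiff ℝ 2 g := hg ▸ hf.log fun q => (hpos q).ne'
  have hfg : f = fun q => Real.exp (g q) := by
    ext q; rw [hg, Real.exp_log (hpos q)]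
  have hne := (hpos p).ne'
  have e1 : ∀ q, Real.log (f q) = g q := fun q => by rw [hg]
  simp only [e1]
  have h1 := kineticOp_exp hg2 (fun _ => 0) p
  have h2 := pd_exp (differentiable_of_two hg2)
  rw [← hfg] at h1
  have e2 : Real.exp (g p) = f p := by rw [hfg]
  rw [e2] at h1
  have h3 : ∀ j, pd f j p = f p * pd g j p := fun j => by
    rw [hfg, h2 j]
  simp only [kineticOp, zero_mul, add_zero, logKineticOp] at h1
  have h4 : ∑ i : Fin n, pd U (Sum.inr i) p * pd f (Sum.inr i) p =
      f p * ∑ i : Fin n, pd U (Sum.inr i) p * pd g (Sum.inr i) p := by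
    simp only [h3, Finset.mul_sum]
    exact Finset.sum_congr rfl fun i _ => by ring
  rw [h4, sub_right_comm, h1, ← mul_sub, inv_mul_cancel_left₀ hne]
  have hU' : ContDiff ℝ 2 fun q => -(1 / 2) * U q := contDiff_const.mul hU
  simp only [logKineticOp, hfun, lapV_fun_add hg2 hU', lapV_const_mul hU,
    pd_fun_add (differentiable_of_two hg2) (differentiable_of_two hU'),
    pd_const_mul (differentiable_of_two hU)]
  have : ∀ A B S1 S2 S3 S4 S5 S6 S7 : ℝ, S1 - S2 + -(1 / 2) * S3 - 1 / 4 * S4 = S5 - S6 - S7 →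
      A + -(1 / 2) * B + S1 - S2 + (-(1 / 2) * S3 + 1 / 2 * B - 1 / 4 * S4) =
        A + S5 - S6 - S7 := by intros; linarith
  refine this _ _ _ _ _ _ _ _ _ ?_
  simp only [Finset.mul_sum, ← Finset.sum_add_distrib, ← Finset.sum_sub_distrib]
  exact Finset.sum_congr rfl fun i _ => by ring

theorem logSolution_log {U : E n × E n → ℝ} (hU : ContDiff ℝ 2 U) {T C a₀ : ℝ} (ha₀ : 0 < a₀)
    (hC : 0 ≤ C) (hUC : ∀ z, |U z| ≤ C * (1 + nsq z)) {ρ : ℝ → E n × E n → ℝ}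
    (hρ : ContDiffOn ℝ (⊤ : ℕ∞) (fun q : ℝ × (E n × E n) => ρ q.1 q.2) (Ioo 0 T ×ˢ univ))
    (hpos : ∀ t ∈ Ioo 0 T, ∀ p : E n × E n, 0 < ρ t p)
    (hpde : ∀ t ∈ Ioo 0 T, ∀ p : E n × E n,
      deriv (fun τ => ρ τ p) t =
        lapV (ρ t) p - (∑ i : Fin n, pd U (Sum.inr i) p * pd (ρ t) (Sum.inr i) p)
          - ∑ i : Fin n, p.2 i * pd (ρ t) (Sum.inl i) p)
    (hgrow1 : ∀ t ∈ Ioo 0 T, ∀ p : E n × E n,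
      Real.sqrt (gradNormSq (ρ t) p) ≤ a₀ * Real.exp (-U p / 2) * (‖p.1‖ + ‖p.2‖)) :
    LogSolution (hfun U) T fun t q => Real.log (ρ t q) + -(1 / 2) * U q := by
  have hopen : IsOpen (Ioo 0 T ×ˢ (univ : Set (E n × E n))) := isOpen_Ioo.prod isOpen_univ
  have hρt : ∀ t ∈ Ioo 0 T, ContDiff ℝ 2 (ρ t) := fun t ht => by
    rw [← contDiffOn_univ]
    have h1 : ContDiff ℝ 2 fun p : E n × E n => (t, p) := contDiff_const.prodMk contDiff_id
    exact (contDiffOn_infty.1 hρ 2).comp h1.contDiffOn fun p _ => ⟨ht, mem_univ _⟩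
  have hdt : ∀ t ∈ Ioo 0 T, ∀ z, HasDerivAt (fun s => ρ s z) (deriv (fun s => ρ s z) t) t := by
    intro t ht z
    have h1 := (hρ.contDiffAt (hopen.mem_nhds (mk_mem_prod ht (mem_univ z)))).differentiableAt
      (by simp)
    have h2 : DifferentiableAt ℝ (fun s : ℝ => (s, z)) t := by fun_prop
    exact (DifferentiableAt.comp t h1 h2).hasDerivAt
  refine ⟨fun t ht => ((hρt t ht).log fun q => (hpos t ht q).ne').add (contDiff_const.mul hU),
    fun t ht z => ?_, ?_, fun τ hτ t ht => ?_⟩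
  · rw [logKineticOp_log_sub hU (hρt t ht) (hpos t ht), ← hpde t ht]
    exact (((hdt t ht z).log (hpos t ht z).ne').add_const _).congr_deriv (by rw [div_eq_inv_mul])
  · refine (hρ.continuousOn.log fun q hq => (hpos _ hq.1 _).ne').add ?_
    have := hU.continuous
    fun_prop
  · have hsub : Icc τ t ⊆ Ioo 0 T := fun s hs => ⟨hτ.1.trans_le hs.1, hs.2.trans_lt ht.2⟩
    have hc : ContinuousOn (fun s => ρ s 0) (Icc τ t) := fun s hs =>
      (hdt s (hsub hs) 0).continuousAt.continuousWithinAt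
    obtain ⟨M, hM⟩ := isCompact_Icc.bddAbove_image hc
    refine ⟨|Real.log (M + a₀)| + (C + 2) + C, fun s hs z => ?_⟩
    have h1 := log_le_of_gradient_bound (M := M) (C := C)
      (differentiable_of_two (hρt s (hsub hs))) (hpos s (hsub hs)) ha₀ hC
      (hM (mem_image_of_mem _ hs)) (fun p => by
        refine (hgrow1 s (hsub hs) p).trans ?_
        have h2 := (abs_le.1 (hUC p)).1
        have h3 : 0 ≤ C * (1 + nsq p) := mul_nonneg hC (by linarith [nsq_nonneg p])
        gcongr
        linarith) z
    have h2 := (abs_le.1 (hUC z)).1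
    have h3 := nsq_nonneg z
    have h4 := mul_nonneg hC (by linarith : 0 ≤ 1 + nsq z)
    nlinarith [le_abs_self (Real.log (M + a₀)), mul_nonneg (abs_nonneg (Real.log (M + a₀))) h3]

/-- A pair `(C, S)` of generalised trigonometric functions: `C' = σ S`, `S' = C`. -/
structure TrigPair (σ : ℝ) (C S : ℝ → ℝ) : Prop where
  deriv_fst : ∀ t, HasDerivAt C (σ * S t) t
  deriv_snd : ∀ t, HasDerivAt S (C t) t
  fst_zero : C 0 = 1
  snd_zero : S 0 = 0
  sq_sub_sq : ∀ t, C t ^ 2 - σ * S t ^ 2 = 1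

section Riccati

variable (σ τ : ℝ) (C S C₂ S₂ : ℝ → ℝ)

/-- Common denominator of the Riccati solution attached to two trigonometric pairs. -/
def riccatiDen (t : ℝ) : ℝ := (σ + τ) * (S t * S₂ t) + 2 * (1 - C t * C₂ t)

/-- Derivative of `riccatiDen`. -/
def riccatiDen' (t : ℝ) : ℝ := (σ - τ) * (C t * S₂ t - S t * C₂ t)

/-- Numerator of the upper left entry of the Riccati solution. -/
def riccatiNumX (t : ℝ) : ℝ := (σ - τ) * (σ * (S t * C₂ t) - τ * (C t * S₂ t))

/-- Numerator of the off-diagonal entry of the Riccati solution. -/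
def riccatiNumXV (t : ℝ) : ℝ := (σ + τ) * (C t * C₂ t - 1) - 2 * σ * τ * (S t * S₂ t)

variable {σ τ C S C₂ S₂}

lemma hasDerivAt_riccatiDen (h : TrigPair σ C S) (h' : TrigPair τ C₂ S₂) (t : ℝ) :
    HasDerivAt (riccatiDen σ τ C S C₂ S₂) (riccatiDen' σ τ C S C₂ S₂ t) t := by
  refine ((((h.deriv_snd t).mul (h'.deriv_snd t)).const_mul (σ + τ)).add
    ((((h.deriv_fst t).mul (h'.deriv_fst t)).const_sub 1).const_mul 2)).congr_deriv ?_
  unfold riccatiDen'; ring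

lemma hasDerivAt_riccatiDen' (h : TrigPair σ C S) (h' : TrigPair τ C₂ S₂) (t : ℝ) :
    HasDerivAt (riccatiDen' σ τ C S C₂ S₂) ((σ - τ) ^ 2 * (S t * S₂ t)) t := by
  refine ((((h.deriv_fst t).mul (h'.deriv_snd t)).sub
    ((h.deriv_snd t).mul (h'.deriv_fst t))).const_mul (σ - τ)).congr_deriv ?_
  ring

lemma hasDerivAt_riccatiNumX (h : TrigPair σ C S) (h' : TrigPair τ C₂ S₂) (t : ℝ) :
    HasDerivAt (riccatiNumX σ τ C S C₂ S₂) ((σ - τ) ^ 2 * (C t * C₂ t)) t := by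
  refine (((((h.deriv_snd t).mul (h'.deriv_fst t)).const_mul σ).sub
    (((h.deriv_fst t).mul (h'.deriv_snd t)).const_mul τ)).const_mul (σ - τ)).congr_deriv ?_
  ring

lemma hasDerivAt_riccatiNumXV (h : TrigPair σ C S) (h' : TrigPair τ C₂ S₂) (t : ℝ) :
    HasDerivAt (riccatiNumXV σ τ C S C₂ S₂) (riccatiNumX σ τ C S C₂ S₂ t) t := by
  refine (((((h.deriv_fst t).mul (h'.deriv_fst t)).sub_const 1).const_mul (σ + τ)).sub
    (((h.deriv_snd t).mul (h'.deriv_snd t)).const_mul (2 * σ * τ))).congr_deriv ?_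
  unfold riccatiNumX; ring

lemma riccati_identity (h : TrigPair σ C S) (h' : TrigPair τ C₂ S₂) (t : ℝ) :
    riccatiNumX σ τ C S C₂ S₂ t * riccatiDen' σ τ C S C₂ S₂ t
        - (σ - τ) ^ 2 * (C t * C₂ t) * riccatiDen σ τ C S C₂ S₂ t =
      riccatiNumXV σ τ C S C₂ S₂ t ^ 2 - σ * τ * riccatiDen σ τ C S C₂ S₂ t ^ 2 := by
  have e := h.sq_sub_sq t
  have e' := h'.sq_sub_sq t
  unfold riccatiNumX riccatiDen' riccatiDen riccatiNumXV
  linear_combination (σ - τ) ^ 2 * (e * (C₂ t ^ 2 - τ * S₂ t ^ 2) + e')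

lemma tendsto_div_pow_succ {f f' : ℝ → ℝ} {L : ℝ} (k : ℕ) (hf : ∀ t, HasDerivAt f (f' t) t)
    (h0 : f 0 = 0) (hL : Filter.Tendsto (fun t => f' t / t ^ k) (nhdsWithin 0 (Ioi 0)) (nhds L)) :
    Filter.Tendsto (fun t => f t / t ^ (k + 1)) (nhdsWithin 0 (Ioi 0)) (nhds (L / (k + 1))) := by
  have hpos : ∀ᶠ t : ℝ in nhdsWithin 0 (Ioi 0), 0 < t := self_mem_nhdsWithin
  refine HasDerivAt.lhopital_zero_nhdsGT (f' := f') (g' := fun t => (k + 1 : ℝ) * t ^ k)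
    (Filter.Eventually.of_forall hf)
    (Filter.Eventually.of_forall fun t => by simpa using hasDerivAt_pow (k + 1) t)
    (hpos.mono fun t ht => by positivity)
    (((hf 0).continuousAt.tendsto.mono_left nhdsWithin_le_nhds).trans (by rw [h0])) ?_ ?_
  · have : Continuous fun t : ℝ => t ^ (k + 1) := by fun_prop
    exact (this.tendsto' 0 0 (by simp)).mono_left nhdsWithin_le_nhds
  · refine (hL.div_const (k + 1 : ℝ)).congr fun t => ?_
    rw [div_div, mul_comm]

lemma riccati_asymptotics (h : TrigPair σ C S) (h' : TrigPair τ C₂ S₂) :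
    Filter.Tendsto (fun t => riccatiNumX σ τ C S C₂ S₂ t / t ^ 1) (nhdsWithin 0 (Ioi 0))
      (nhds ((σ - τ) ^ 2)) ∧
    Filter.Tendsto (fun t => riccatiNumXV σ τ C S C₂ S₂ t / t ^ 2) (nhdsWithin 0 (Ioi 0))
      (nhds ((σ - τ) ^ 2 / 2)) ∧
    Filter.Tendsto (fun t => riccatiDen' σ τ C S C₂ S₂ t / t ^ 3) (nhdsWithin 0 (Ioi 0))
      (nhds ((σ - τ) ^ 2 / 3)) ∧
    Filter.Tendsto (fun t => riccatiDen σ τ C S C₂ S₂ t / t ^ 4) (nhdsWithin 0 (Ioi 0))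
      (nhds ((σ - τ) ^ 2 / 12)) := by
  have hC : Filter.Tendsto C (nhdsWithin 0 (Ioi 0)) (nhds 1) :=
    h.fst_zero ▸ (h.deriv_fst 0).continuousAt.tendsto.mono_left nhdsWithin_le_nhds
  have hC' : Filter.Tendsto C₂ (nhdsWithin 0 (Ioi 0)) (nhds 1) :=
    h'.fst_zero ▸ (h'.deriv_fst 0).continuousAt.tendsto.mono_left nhdsWithin_le_nhds
  have hS : Filter.Tendsto (fun t => S t / t ^ 1) (nhdsWithin 0 (Ioi 0)) (nhds 1) := by
    simpa using tendsto_div_pow_succ 0 h.deriv_snd h.snd_zero (by simpa using hC)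
  have hS' : Filter.Tendsto (fun t => S₂ t / t ^ 1) (nhdsWithin 0 (Ioi 0)) (nhds 1) := by
    simpa using tendsto_div_pow_succ 0 h'.deriv_snd h'.snd_zero (by simpa using hC')
  have hX : Filter.Tendsto (fun t => riccatiNumX σ τ C S C₂ S₂ t / t ^ 1) (nhdsWithin 0 (Ioi 0))
      (nhds ((σ - τ) ^ 2)) := by
    have := tendsto_div_pow_succ 0 (hasDerivAt_riccatiNumX h h')
      (by simp [riccatiNumX, h.snd_zero, h'.snd_zero])
      (by simpa using (hC.mul hC').const_mul ((σ - τ) ^ 2))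
    simpa using this
  have hD' : Filter.Tendsto (fun t => riccatiDen' σ τ C S C₂ S₂ t / t ^ 3) (nhdsWithin 0 (Ioi 0))
      (nhds ((σ - τ) ^ 2 / 3)) := by
    have := tendsto_div_pow_succ 2 (L := (σ - τ) ^ 2) (hasDerivAt_riccatiDen' h h')
      (by simp [riccatiDen', h.snd_zero, h'.snd_zero]) (by
        have := (hS.mul hS').const_mul ((σ - τ) ^ 2)
        rw [mul_one, mul_one] at this
        refine this.congr fun t => ?_
        rw [div_mul_div_comm, mul_div_assoc]; ring_nf)
    convert this using 2; norm_num
  refine ⟨hX, ?_, hD', ?_⟩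
  · have := tendsto_div_pow_succ 1 (hasDerivAt_riccatiNumXV h h')
      (by simp [riccatiNumXV, h.snd_zero, h.fst_zero, h'.fst_zero]) hX
    convert this using 2; norm_num
  · have := tendsto_div_pow_succ 3 (hasDerivAt_riccatiDen h h')
      (by simp [riccatiDen, h.snd_zero, h.fst_zero, h'.fst_zero]) hD'
    convert this using 2; norm_num; ring

lemma riccati_blowdown_aux {ε D t M X V N d p q ip : ℝ} (hε : ε = D / 100) (hD : 0 < D) (ht : 0 < t)
    (ht1 : t < 1) (htM : t * (50 * (|M| + 1)) ≤ 3)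
    (hX : (D - ε) * t ≤ X) (hV : |V - D / 2 * t ^ 2| ≤ ε * t ^ 2) (hN : (D / 3 - ε) * t ^ 3 ≤ N)
    (hd : 0 < d) (hd' : d ≤ D / 6 * t ^ 4) (hip : |ip| ≤ p * q) :
    M * (p ^ 2 + q ^ 2) * (2 * d) ≤ X * p ^ 2 - 2 * V * ip + N * q ^ 2 := by
  subst hε
  have h1 : |V| ≤ (51 / 100) * D * t ^ 2 := by
    rw [abs_le] at hV ⊢
    constructor <;> nlinarith [mul_pos hD (sq_pos_of_pos ht), hV.1, hV.2]
  have h2 : V * ip ≤ (51 / 100) * D * t ^ 2 * (p * q) :=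
    (le_abs_self _).trans (by rw [abs_mul]; exact mul_le_mul h1 hip (abs_nonneg _) (by positivity))
  have h3 : M * (p ^ 2 + q ^ 2) * (2 * d) ≤ |M| * (p ^ 2 + q ^ 2) * (2 * (D / 6 * t ^ 4)) := by
    have := le_abs_self M
    gcongr
  have h4 : |M| * t ≤ 3 / 50 := by nlinarith [abs_nonneg M]
  have h5 : |M| * (p ^ 2 + q ^ 2) * (2 * (D / 6 * t ^ 4)) ≤ D * t / 50 * (p ^ 2 + (t * q) ^ 2) := by
    have e1 : t ^ 2 * p ^ 2 ≤ p ^ 2 := by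
      have : t ^ 2 ≤ 1 := by nlinarith
      nlinarith [sq_nonneg p]
    calc _ = |M| * t * (D * t / 3 * (t ^ 2 * p ^ 2 + (t * q) ^ 2)) := by ring
      _ ≤ 3 / 50 * (D * t / 3 * (p ^ 2 + (t * q) ^ 2)) := by gcongr
      _ = _ := by ring
  have h6 : (D - D / 100) * t * p ^ 2 ≤ X * p ^ 2 := by gcongr
  have h7 : (D / 3 - D / 100) * t ^ 3 * q ^ 2 ≤ N * q ^ 2 := by gcongr
  have h8 : 0 ≤ D * t * ((p - 51 / 97 * (t * q)) ^ 2 * (97 / 100) +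
      (t * q) ^ 2 * (1 / 3 - 3 / 100 - 2601 / 9700)) := by
    have : (0 : ℝ) ≤ 1 / 3 - 3 / 100 - 2601 / 9700 := by norm_num
    positivity
  nlinarith

lemma riccati_blowdown (h : TrigPair σ C S) (h' : TrigPair τ C₂ S₂) (hστ : σ ≠ τ)
    {θ : ℝ} (hθ : 0 < θ)
    (hpos : ∀ t ∈ Ioo 0 θ, 0 < riccatiDen σ τ C S C₂ S₂ t) (M : ℝ) :
    ∃ δ > 0, ∀ t ∈ Ioo 0 δ, ∀ y : E n × E n,
      1 / 2 * blockForm (-(riccatiNumX σ τ C S C₂ S₂ t / riccatiDen σ τ C S C₂ S₂ t))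
        (riccatiNumXV σ τ C S C₂ S₂ t / riccatiDen σ τ C S C₂ S₂ t)
        (-(riccatiDen' σ τ C S C₂ S₂ t / riccatiDen σ τ C S C₂ S₂ t)) y ≤ -M * nsq y := by
  obtain ⟨hX, hV, hN, hd⟩ := riccati_asymptotics h h'
  have hD : 0 < (σ - τ) ^ 2 := by have := sub_ne_zero.2 hστ; positivity
  set D := (σ - τ) ^ 2
  have hM : 0 < 3 / (50 * (|M| + 1)) := by positivity
  have hlt : ∀ {r : ℝ}, 0 < r → ∀ᶠ t : ℝ in nhdsWithin 0 (Ioi 0), t < r := fun hr =>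
    nhdsWithin_le_nhds (gt_mem_nhds hr)
  have hpos' : ∀ᶠ t : ℝ in nhdsWithin 0 (Ioi 0), 0 < t := self_mem_nhdsWithin
  have key : ∀ᶠ t in nhdsWithin 0 (Ioi 0), ∀ y : E n × E n,
      1 / 2 * blockForm (-(riccatiNumX σ τ C S C₂ S₂ t / riccatiDen σ τ C S C₂ S₂ t))
        (riccatiNumXV σ τ C S C₂ S₂ t / riccatiDen σ τ C S C₂ S₂ t)
        (-(riccatiDen' σ τ C S C₂ S₂ t / riccatiDen σ τ C S C₂ S₂ t)) y ≤ -M * nsq y := by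
    filter_upwards [hpos', hlt one_pos, hlt hM, hlt hθ,
      hX.eventually (lt_mem_nhds (show D - D / 100 < D by linarith)),
      hV.eventually (lt_mem_nhds (show D / 2 - D / 100 < D / 2 by linarith)),
      hV.eventually (gt_mem_nhds (show D / 2 < D / 2 + D / 100 by linarith)),
      hN.eventually (lt_mem_nhds (show D / 3 - D / 100 < D / 3 by linarith)),
      hd.eventually (gt_mem_nhds (show D / 12 < D / 6 by linarith))]
      with t h0 h1 hM hθ hX hV hV' hN hd y
    have hden := hpos t ⟨h0, hθ⟩
    rw [lt_div_iff₀ (by positivity)] at hX hV hM hN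
    rw [div_lt_iff₀ (by positivity)] at hV' hd
    rw [pow_one] at hX
    have := riccati_blowdown_aux (M := M) (V := riccatiNumXV σ τ C S C₂ S₂ t)
      (ip := inner ℝ y.1 y.2) rfl hD h0 h1 hM.le hX.le
      (abs_le.2 ⟨by linarith, by linarith⟩) hN.le hden hd.le
      (abs_real_inner_le_norm _ _)
    unfold blockForm nsq
    rw [← sub_nonneg] at this ⊢
    refine le_of_le_of_eq (div_nonneg this (by positivity : 0 ≤ 2 * riccatiDen σ τ C S C₂ S₂ t)) ?_
    field_simp
    ring
  obtain ⟨δ, hδ, hk⟩ := mem_nhdsGT_iff_exists_Ioo_subset.1 key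
  exact ⟨δ, hδ, fun t ht => hk ht⟩

theorem riccatiTriple_of_trigPair (h : TrigPair σ C S) (h' : TrigPair τ C₂ S₂) (hστ : σ ≠ τ)
    {θ : ℝ} (hθ : 0 < θ)
    (hpos : ∀ t ∈ Ioo 0 θ, 0 < riccatiDen σ τ C S C₂ S₂ t) {k₁ k₂ : ℝ} (hk₁ : σ * τ = 2 * k₁)
    (hk₂ : σ + τ = 2 * k₂) :
    RiccatiTriple n k₁ k₂ θ
      (fun t => -(riccatiNumX σ τ C S C₂ S₂ t / riccatiDen σ τ C S C₂ S₂ t))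
      (fun t => riccatiNumXV σ τ C S C₂ S₂ t / riccatiDen σ τ C S C₂ S₂ t)
      (fun t => -(riccatiDen' σ τ C S C₂ S₂ t / riccatiDen σ τ C S C₂ S₂ t)) where
  deriv_a t ht := by
    have hd := (hpos t ht).ne'
    refine ((hasDerivAt_riccatiNumX h h' t).div (hasDerivAt_riccatiDen h h' t)
      hd).neg.congr_deriv ?_
    have := riccati_identity h h' t
    field_simp
    linear_combination this + riccatiDen σ τ C S C₂ S₂ t ^ 2 * -hk₁
  deriv_b t ht := by
    have hd := (hpos t ht).ne'
    refine ((hasDerivAt_riccatiNumXV h h' t).div (hasDerivAt_riccatiDen h h' t) hd).congr_deriv ?_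
    field_simp
    ring
  deriv_c t ht := by
    have hd := (hpos t ht).ne'
    refine ((hasDerivAt_riccatiDen' h h' t).div (hasDerivAt_riccatiDen h h' t)
      hd).neg.congr_deriv ?_
    have : (σ - τ) ^ 2 * (S t * S₂ t) = 2 * riccatiNumXV σ τ C S C₂ S₂ t +
        (σ + τ) * riccatiDen σ τ C S C₂ S₂ t := by
      unfold riccatiNumXV riccatiDen; ring
    rw [this]
    field_simp
    linear_combination -riccatiDen σ τ C S C₂ S₂ t ^ 2 * hk₂
  blowdown := riccati_blowdown h h' hστ hθ hpos

end Riccati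

section TrigPair

variable {σ τ : ℝ} {C S C₂ S₂ : ℝ → ℝ}

lemma trigPair_hyperbolic {l : ℝ} (hl : l ≠ 0) :
    TrigPair (l ^ 2) (fun t => Real.cosh (l * t)) fun t => Real.sinh (l * t) / l where
  deriv_fst t := (((hasDerivAt_id t).const_mul l).cosh).congr_deriv (by field_simp; simp)
  deriv_snd t := ((((hasDerivAt_id t).const_mul l).sinh).div_const l).congr_deriv
    (by field_simp; simp)
  fst_zero := by simp
  snd_zero := by simp
  sq_sub_sq t := by
    have := Real.cosh_sq_sub_sinh_sq (l * t)
    field_simp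
    linarith

lemma trigPair_elliptic {l : ℝ} (hl : l ≠ 0) :
    TrigPair (-l ^ 2) (fun t => Real.cos (l * t)) fun t => Real.sin (l * t) / l where
  deriv_fst t := (((hasDerivAt_id t).const_mul l).cos).congr_deriv (by field_simp; simp)
  deriv_snd t := ((((hasDerivAt_id t).const_mul l).sin).div_const l).congr_deriv
    (by field_simp; simp)
  fst_zero := by simp
  snd_zero := by simp
  sq_sub_sq t := by
    have := Real.cos_sq_add_sin_sq (l * t)
    field_simp
    linarith

lemma pos_of_hasDerivAt_pos {f f' : ℝ → ℝ} (hf : ∀ t, HasDerivAt f (f' t) t) (h0 : f 0 = 0)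
    (hf' : ∀ t, 0 < t → 0 < f' t) {t : ℝ} (ht : 0 < t) : 0 < f t := by
  have : StrictMonoOn f (Ici 0) :=
    strictMonoOn_of_deriv_pos (convex_Ici 0) (fun t _ => (hf t).continuousAt.continuousWithinAt)
      fun t ht => by
        rw [interior_Ici] at ht
        rw [(hf t).deriv]
        exact hf' t ht
  exact h0 ▸ this self_mem_Ici ht.le ht

lemma riccatiDen_pos_of_pos (h : TrigPair σ C S) (h' : TrigPair τ C₂ S₂) (hστ : σ ≠ τ)
    (hS : ∀ t, 0 < t → 0 < S t) (hS' : ∀ t, 0 < t → 0 < S₂ t) {t : ℝ} (ht : 0 < t) :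
    0 < riccatiDen σ τ C S C₂ S₂ t := by
  have hD : 0 < (σ - τ) ^ 2 := by have := sub_ne_zero.2 hστ; positivity
  refine pos_of_hasDerivAt_pos (hasDerivAt_riccatiDen h h')
    (by simp [riccatiDen, h.snd_zero, h.fst_zero, h'.fst_zero]) (fun t ht => ?_) ht
  exact pos_of_hasDerivAt_pos (hasDerivAt_riccatiDen' h h')
    (by simp [riccatiDen', h.snd_zero, h'.snd_zero])
    (fun t ht => mul_pos hD (mul_pos (hS t ht) (hS' t ht))) ht

/-- A one-sided bound on the logarithmic derivative keeps the denominator positive. -/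
lemma riccatiDen_pos_of_bound (h : TrigPair σ C S) (h' : TrigPair τ C₂ S₂) (hστ : σ ≠ τ) {Λ : ℝ}
    (hΛ : ∀ θ > 0, (∀ t ∈ Ioo 0 θ, 0 < riccatiDen σ τ C S C₂ S₂ t) → ∀ t ∈ Ioo 0 θ,
      -(riccatiDen' σ τ C S C₂ S₂ t / riccatiDen σ τ C S C₂ S₂ t) ≤ Λ) {t : ℝ} (ht : 0 < t) :
    0 < riccatiDen σ τ C S C₂ S₂ t := by
  by_contra! hneg
  have hD : 0 < (σ - τ) ^ 2 := by have := sub_ne_zero.2 hστ; positivity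
  have hcont : Continuous (riccatiDen σ τ C S C₂ S₂) :=
    continuous_iff_continuousAt.2 fun t => (hasDerivAt_riccatiDen h h' t).continuousAt
  obtain ⟨δ, hδ, hpos⟩ := mem_nhdsGT_iff_exists_Ioo_subset.1
    ((riccati_asymptotics h h').2.2.2.eventually
      (lt_mem_nhds (show 0 < (σ - τ) ^ 2 / 12 by positivity)))
  have hδpos : ∀ t ∈ Ioo 0 δ, 0 < riccatiDen σ τ C S C₂ S₂ t := fun s hs =>
    (div_pos_iff_of_pos_right (pow_pos hs.1 4)).1 (hpos hs)
  have hδt : δ ≤ t := by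
    by_contra! hlt
    exact (hδpos t ⟨ht, hlt⟩).not_ge hneg
  have hcomp : IsCompact (Icc δ t ∩ {s | riccatiDen σ τ C S C₂ S₂ s ≤ 0}) :=
    isCompact_Icc.inter_right (isClosed_le hcont continuous_const)
  obtain ⟨r, ⟨hr, hr0⟩, hmin⟩ := hcomp.exists_isLeast ⟨t, ⟨hδt, le_rfl⟩, hneg⟩
  have hrpos : 0 < r := hδ.trans_le hr.1
  have hlt : ∀ s ∈ Ioo 0 r, 0 < riccatiDen σ τ C S C₂ S₂ s := by
    intro s hs
    by_contra! hs'
    rcases lt_or_ge s δ with hsδ | hsδ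
    · exact (hδpos s ⟨hs.1, hsδ⟩).not_ge hs'
    · exact hs.2.not_ge (hmin ⟨⟨hsδ, hs.2.le.trans hr.2⟩, hs'⟩)
  have hder : ∀ s, HasDerivAt (fun s => riccatiDen σ τ C S C₂ S₂ s * Real.exp (Λ * s))
      ((riccatiDen' σ τ C S C₂ S₂ s + Λ * riccatiDen σ τ C S C₂ S₂ s) * Real.exp (Λ * s)) s := by
    intro s
    refine ((hasDerivAt_riccatiDen h h' s).mul
      (((hasDerivAt_id s).const_mul Λ).exp)).congr_deriv ?_
    simp only [id]; ring
  have hmono : MonotoneOn (fun s => riccatiDen σ τ C S C₂ S₂ s * Real.exp (Λ * s))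
      (Icc (r / 2) r) := by
    refine monotoneOn_of_deriv_nonneg (convex_Icc _ _)
      (fun s _ => (hder s).continuousAt.continuousWithinAt)
      (fun s _ => (hder s).differentiableAt.differentiableWithinAt) fun s hs => ?_
    rw [interior_Icc] at hs
    have hs' : s ∈ Ioo 0 r := ⟨by linarith [hs.1], hs.2⟩
    have hb := hΛ r hrpos hlt s hs'
    rw [← neg_div, div_le_iff₀ (hlt s hs')] at hb
    rw [(hder s).deriv]
    exact mul_nonneg (by linarith) (Real.exp_pos _).le
  have h1 := hmono ⟨le_rfl, by linarith⟩ ⟨by linarith, le_rfl⟩ (by linarith : r / 2 ≤ r)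
  have h2 : 0 < riccatiDen σ τ C S C₂ S₂ (r / 2) * Real.exp (Λ * (r / 2)) :=
    mul_pos (hlt _ ⟨by linarith, by linarith⟩) (Real.exp_pos _)
  have h3 : riccatiDen σ τ C S C₂ S₂ r * Real.exp (Λ * r) ≤ 0 :=
    mul_nonpos_of_nonpos_of_nonneg hr0 (Real.exp_pos _).le
  exact (h2.trans_le h1).not_ge h3

lemma riccatiDen_elliptic_nonpos {l l' : ℝ} (hl' : 0 < l') (hlt : l' < l) :
    riccatiDen (-l ^ 2) (-l' ^ 2) (fun t => Real.cos (l * t)) (fun t => Real.sin (l * t) / l)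
      (fun t => Real.cos (l' * t)) (fun t => Real.sin (l' * t) / l') (2 * π / (l - l')) ≤ 0 := by
  have hl : 0 < l := hl'.trans hlt
  have hsub : l - l' ≠ 0 := (sub_pos.2 hlt).ne'
  have e : l * (2 * π / (l - l')) = l' * (2 * π / (l - l')) + 2 * π := by
    field_simp; ring
  unfold riccatiDen
  simp only [e, Real.cos_add_two_pi, Real.sin_add_two_pi]
  set x := l' * (2 * π / (l - l'))
  have hx := Real.cos_sq_add_sin_sq x
  have : (-l ^ 2 + -l' ^ 2) * (Real.sin x / l * (Real.sin x / l')) +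
      2 * (1 - Real.cos x * Real.cos x) = -((l - l') ^ 2 * Real.sin x ^ 2 / (l * l')) := by
    have hc : Real.cos x * Real.cos x = 1 - Real.sin x ^ 2 := by linarith
    rw [hc]
    field_simp
    ring
  rw [this, neg_nonpos]
  positivity

end TrigPair

lemma le_hessForm_of_midpointBound {m : E n × E n → ℝ} (hm : ContDiff ℝ 2 m) {a b c : ℝ}
    (h : MidpointBound m a b c) (p y : E n × E n) : 1 / 2 * blockForm a b c y ≤ hessForm m p y := by
  refine le_hessForm_of_midpoint hm p y _ (Filter.Eventually.of_forall fun s => ?_)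
  have := h p (s • y)
  have e : blockForm a b c (s • y) = s ^ 2 * blockForm a b c y := by
    simp only [blockForm, Prod.smul_fst, Prod.smul_snd, norm_smul, inner_smul_left,
      inner_smul_right, mul_pow, Real.norm_eq_abs, sq_abs, conj_trivial]
    ring
  unfold twoPoint at this
  rw [e] at this
  linarith

lemma le_midpoint_of_posSemidef {φ : E n × E n → ℝ} (hφ : ContDiff ℝ 2 φ) {a b : ℝ}
    (h : ∀ p, (Hess φ p - _root_.blockDiag n (-a) (-b)).PosSemidef) (z y : E n × E n) :
    -a * ‖y.1‖ ^ 2 - b * ‖y.2‖ ^ 2 ≤ φ (z + y) + φ (z - y) - 2 * φ z := by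
  have h1 := le_of_le_hessForm hφ (p := z) (y := y) fun s _ => le_hessForm_of_posSemidef (h _) y
  have h2 := le_of_le_hessForm hφ (p := z) (y := -y) fun s _ => le_hessForm_of_posSemidef (h _) (-y)
  simp only [map_neg, Prod.fst_neg, Prod.snd_neg, norm_neg, ← sub_eq_add_neg] at h1 h2
  linarith

/-- The spectral condition excludes `k₂ < 0`: the stationary solution bounds the Riccati solution,
whose trigonometric denominator would otherwise vanish in finite time. -/
theorem nonneg_of_stationary {U : E n × E n → ℝ} (hn : 1 ≤ n) (hU : ContDiff ℝ 2 U) {C Ch k₁ k₂ : ℝ}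
    (hUC : ∀ z, |U z| ≤ C * (1 + nsq z)) (hCh : 0 ≤ Ch) (hup : ∀ z, hfun U z ≤ Ch * (1 + nsq z))
    (hk₁ : 0 < 2 * k₁) (hk₂ : 2 * k₁ < k₂ ^ 2)
    (hmid : ∀ z y : E n × E n, -k₁ * ‖y.1‖ ^ 2 - k₂ * ‖y.2‖ ^ 2 ≤
      hfun U (z + y) + hfun U (z - y) - 2 * hfun U z) : 0 ≤ k₂ := by
  by_contra! hneg
  set r := Real.sqrt (k₂ ^ 2 - 2 * k₁) with hr
  have hr2 : r ^ 2 = k₂ ^ 2 - 2 * k₁ := Real.sq_sqrt (by linarith)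
  have hr0 : 0 < r := Real.sqrt_pos.2 (by linarith)
  have hrk : r < -k₂ := by nlinarith
  set l := Real.sqrt (-k₂ + r) with hl
  set l' := Real.sqrt (-k₂ - r) with hl'
  have hl2 : l ^ 2 = -k₂ + r := Real.sq_sqrt (by linarith)
  have hl2' : l' ^ 2 = -k₂ - r := Real.sq_sqrt (by linarith)
  have hl0' : 0 < l' := Real.sqrt_pos.2 (by linarith)
  have hll : l' < l := Real.sqrt_lt_sqrt (by linarith) (by linarith)
  have hl0 : 0 < l := hl0'.trans hll
  have hne : -l ^ 2 ≠ -l' ^ 2 := by rw [hl2, hl2']; intro h; linarith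
  have P := trigPair_elliptic hl0.ne'
  have P' := trigPair_elliptic hl0'.ne'
  have hφ : ContDiff ℝ 2 fun q => -(1 / 2) * U q := contDiff_const.mul hU
  set y : E n × E n := (0, EuclideanSpace.single ⟨0, hn⟩ 1) with hy
  refine (riccatiDen_elliptic_nonpos hl0' hll).not_gt (riccatiDen_pos_of_bound P P' hne
    (Λ := 2 * hessForm (fun q => -(1 / 2) * U q) 0 y) (fun θ hθ hpos t ht => ?_)
    (by have := sub_pos.2 hll; positivity))
  have hS := riccatiTriple_of_trigPair (n := n) P P' hne hθ hpos (k₁ := k₁) (k₂ := k₂)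
    (by rw [hl2, hl2']; nlinarith) (by rw [hl2, hl2']; ring)
  have := le_hessForm_of_midpointBound hφ
    ((logSolution_stationary hU θ hUC).midpointBound hmid hup hCh hS ht ht.2) 0 y
  simp only [blockForm, hy, norm_zero, inner_zero_left, PiLp.norm_single, norm_one] at this
  linarith

lemma lam_properties {k₁ k₂ : ℝ} (hk₁ : 0 < 2 * k₁) (hk₂ : 2 * k₁ < k₂ ^ 2) (h0 : 0 ≤ k₂) :
    0 < lam2 k₁ k₂ ∧ lam2 k₁ k₂ < lam1 k₁ k₂ ∧
      (lam1 k₁ k₂) ^ 2 * (lam2 k₁ k₂) ^ 2 = 2 * k₁ ∧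
      (lam1 k₁ k₂) ^ 2 + (lam2 k₁ k₂) ^ 2 = 2 * k₂ := by
  unfold lam1 lam2
  set r := Real.sqrt (k₂ ^ 2 - 2 * k₁) with hr
  have hr2 : r ^ 2 = k₂ ^ 2 - 2 * k₁ := Real.sq_sqrt (by linarith)
  have hr0 : 0 < r := Real.sqrt_pos.2 (by linarith)
  have hrk : r < k₂ := by nlinarith
  rw [Real.sq_sqrt (by linarith), Real.sq_sqrt (by linarith)]
  exact ⟨Real.sqrt_pos.2 (by linarith), Real.sqrt_lt_sqrt (by linarith) (by linarith),
    by nlinarith, by ring⟩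

/-- In the hyperbolic case the Riccati solution is the right-hand side of the Harnack inequality. -/
theorem exists_riccatiTriple_harnackMatrix {k₁ k₂ : ℝ} (hk₁ : 0 < 2 * k₁) (hk₂ : 2 * k₁ < k₂ ^ 2)
    (h0 : 0 ≤ k₂) {θ : ℝ} (hθ : 0 < θ) : ∃ a b c : ℝ → ℝ, RiccatiTriple n k₁ k₂ θ a b c ∧
      ∀ t, harnackMatrix n (s0A k₁ k₂) (s1A k₁ k₂) (s2A k₁ k₂) t =
        (1 / 2 : ℝ) • Matrix.fromBlocks (a t • 1) (b t • 1) (b t • 1) (c t • 1) := by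
  obtain ⟨hl', hlt, hmul, hadd⟩ := lam_properties hk₁ hk₂ h0
  have hl := hl'.trans hlt
  have hne : (lam1 k₁ k₂) ^ 2 ≠ (lam2 k₁ k₂) ^ 2 := (pow_lt_pow_left₀ hlt hl'.le two_ne_zero).ne'
  have P := trigPair_hyperbolic hl.ne'
  have P' := trigPair_hyperbolic hl'.ne'
  have hsinh : ∀ l : ℝ, 0 < l → ∀ t, 0 < t → 0 < Real.sinh (l * t) / l := fun l hl t ht =>
    div_pos (Real.sinh_pos_iff.2 (mul_pos hl ht)) hl
  refine ⟨_, _, _, riccatiTriple_of_trigPair P P' hne hθ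
    (fun t ht => riccatiDen_pos_of_pos P P' hne (hsinh _ hl) (hsinh _ hl') ht.1) hmul hadd,
    fun t => ?_⟩
  have hd : s0A k₁ k₂ = fun t => lam1 k₁ k₂ * lam2 k₁ k₂ * riccatiDen ((lam1 k₁ k₂) ^ 2)
      ((lam2 k₁ k₂) ^ 2) (fun t => Real.cosh (lam1 k₁ k₂ * t))
      (fun t => Real.sinh (lam1 k₁ k₂ * t) / lam1 k₁ k₂) (fun t => Real.cosh (lam2 k₁ k₂ * t))
      (fun t => Real.sinh (lam2 k₁ k₂ * t) / lam2 k₁ k₂) t := by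
    ext t; unfold s0A riccatiDen; field_simp
  have hprod : lam1 k₁ k₂ * lam2 k₁ k₂ ≠ 0 := (mul_pos hl hl').ne'
  have e1 : s1A k₁ k₂ t = lam1 k₁ k₂ * lam2 k₁ k₂ * riccatiNumX ((lam1 k₁ k₂) ^ 2)
      ((lam2 k₁ k₂) ^ 2) (fun t => Real.cosh (lam1 k₁ k₂ * t))
      (fun t => Real.sinh (lam1 k₁ k₂ * t) / lam1 k₁ k₂) (fun t => Real.cosh (lam2 k₁ k₂ * t))
      (fun t => Real.sinh (lam2 k₁ k₂ * t) / lam2 k₁ k₂) t := by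
    unfold s1A riccatiNumX; field_simp
  have e2 : s2A k₁ k₂ t = lam1 k₁ k₂ * lam2 k₁ k₂ * riccatiNumXV ((lam1 k₁ k₂) ^ 2)
      ((lam2 k₁ k₂) ^ 2) (fun t => Real.cosh (lam1 k₁ k₂ * t))
      (fun t => Real.sinh (lam1 k₁ k₂ * t) / lam1 k₁ k₂) (fun t => Real.cosh (lam2 k₁ k₂ * t))
      (fun t => Real.sinh (lam2 k₁ k₂ * t) / lam2 k₁ k₂) t := by
    unfold s2A riccatiNumXV; field_simp
  unfold harnackMatrix
  rw [e1, e2, hd, ((hasDerivAt_riccatiDen P P' t).const_mul (lam1 k₁ k₂ * lam2 k₁ k₂)).deriv]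
  simp only [mul_div_mul_left _ _ hprod]

lemma hessForm_fun_add {φ χ : E n × E n → ℝ} (hφ : ContDiff ℝ 2 φ) (hχ : ContDiff ℝ 2 χ)
    (p y : E n × E n) : hessForm (fun q => φ q + χ q) p y = hessForm φ p y + hessForm χ p y := by
  have e : ∀ i j, Hess (fun q => φ q + χ q) p i j = Hess φ p i j + Hess χ p i j := fun i j => by
    simp only [Hess, Matrix.of_apply,
      pd_fun_add (differentiable_of_two hφ) (differentiable_of_two hχ),
      pd_fun_add (differentiable_pd hφ j) (differentiable_pd hχ j)]
  simp only [hessForm, e, mul_add, Finset.sum_add_distrib]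

lemma harnackMatrix_isHermitian (s₀ s₁ s₂ : ℝ → ℝ) (t : ℝ) :
    (harnackMatrix n s₀ s₁ s₂ t).IsHermitian := by
  unfold harnackMatrix
  simp [Matrix.IsHermitian, Matrix.fromBlocks_transpose]

end

/-- **Matrix differential Harnack inequality, case `k₂² > 2k₁ > 0`** (Theorem 2.1 (1)). -/
theorem matrix_harnack_case1
    (n : ℕ) (hn : 1 ≤ n) (T : ℝ) (hT : 0 < T)
    (U : E n × E n → ℝ) (hU : ContDiff ℝ (⊤ : ℕ∞) U)
    (ρ : ℝ → E n × E n → ℝ)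
    (hρ : ContDiffOn ℝ (⊤ : ℕ∞) (fun q : ℝ × (E n × E n) => ρ q.1 q.2) (Ioo 0 T ×ˢ univ))
    (hpos : ∀ t ∈ Ioo 0 T, ∀ p : E n × E n, 0 < ρ t p)
    (hpde : ∀ t ∈ Ioo 0 T, ∀ p : E n × E n,
      deriv (fun τ => ρ τ p) t =
        lapV (ρ t) p - (∑ i : Fin n, pd U (Sum.inr i) p * pd (ρ t) (Sum.inr i) p)
          - ∑ i : Fin n, p.2 i * pd (ρ t) (Sum.inl i) p)
    (a₀ a₁ : ℝ) (ha₀ : 0 < a₀) (ha₁ : 0 < a₁)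
    (hgrow1 : ∀ t ∈ Ioo 0 T, ∀ p : E n × E n,
      Real.sqrt (gradNormSq (ρ t) p) ≤ a₀ * Real.exp (-U p / 2) * (‖p.1‖ + ‖p.2‖))
    (hgrow2 : ∀ t ∈ Ioo 0 T, ∀ p : E n × E n,
      (Hess (ρ t) p + (a₀ * Real.exp (a₁ * (‖p.1‖ ^ 2 + ‖p.2‖ ^ 2))) •
        (1 : Matrix (Fin n ⊕ Fin n) (Fin n ⊕ Fin n) ℝ)).PosSemidef)
    (hgrow3 : ∀ p : E n × E n,
      ((a₀ * Real.exp (a₁ * (‖p.1‖ ^ 2 + ‖p.2‖ ^ 2))) •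
        (1 : Matrix (Fin n ⊕ Fin n) (Fin n ⊕ Fin n) ℝ) - Hess U p).PosSemidef)
    (k₁ k₂ : ℝ) (hk₁ : 0 < 2 * k₁) (hk₂ : 2 * k₁ < k₂ ^ 2)
    (hh : ∀ p : E n × E n, (Hess (hfun U) p - blockDiag n (-k₁) (-k₂)).PosSemidef) :
    ∀ t ∈ Ioo 0 T, ∀ p : E n × E n,
      (Hess (fun q => Real.log (ρ t q)) p - (1/2 : ℝ) • Hess U p
        - harnackMatrix n (s0A k₁ k₂) (s1A k₁ k₂) (s2A k₁ k₂) t).PosSemidef := by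
  intro t ht p
  have hU2 := contDiff_two_of_top hU
  have hK : 0 ≤ |k₁| + |k₂| := by positivity
  have hconv := neg_le_hessForm_of_posSemidef hh
  have hmid := le_midpoint_of_posSemidef (contDiff_hfun hU) hh
  obtain ⟨C, hC, hUC⟩ := exists_abs_potential_le hU ha₀ ha₁ hK hgrow3 hconv
  obtain ⟨Ch, hCh, hup⟩ := exists_hfun_upper hU2 (contDiff_hfun hU) hC hK hUC hconv
  have hk₂0 := nonneg_of_stationary hn hU2 hUC hCh hup hk₁ hk₂ hmid
  obtain ⟨a, b, c, hS, hmat⟩ := exists_riccatiTriple_harnackMatrix (n := n) hk₁ hk₂ hk₂0 hT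
  have hsol := logSolution_log hU2 ha₀ hC hUC hρ hpos hpde hgrow1
  have hlog : ContDiff ℝ 2 fun q => Real.log (ρ t q) := by
    have := (hsol.contDiff t ht).add (contDiff_const (c := (1 / 2 : ℝ)).mul hU2)
    convert this using 1
    ext q
    ring
  have hφ : ContDiff ℝ 2 fun q => -(1 / 2) * U q := contDiff_const.mul hU2
  refine posSemidef_of_form (((hess_isHermitian hlog p).sub ?_).sub
    (harnackMatrix_isHermitian _ _ _ t)) fun y => ?_
  · have := hess_isHermitian hU2 p
    simpa [Matrix.IsHermitian] using this
  · have h1 := le_hessForm_of_midpointBound (hsol.contDiff t ht)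
      (hsol.midpointBound hmid hup hCh hS ht ht.2) p y
    rw [hessForm_fun_add hlog hφ, hessForm_const_mul hU2] at h1
    rw [form_sub, form_sub, form_smul, hmat t, form_smul, form_fromBlocks]
    unfold hessForm at h1
    linarith
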